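/- arXiv:2206.01454 — 3 statements merged into one kernel-verified Lean document; each statement's English description precedes it below -/
import Mathlib

section
/- (Active Lower Bound; Theorem 4.) With 𝒵 = [0,1]^{d_Z} and 𝒳 = ℝ^{d_X}, there exist constants c_1, c_2 > 0, depending only on L_g, s_g, L_f, s_f, d_X, d_Z, such that for every active estimator f̂_{x_0} (any sequential procedure in which each Z_i is a measurable, possibly randomized, function of the previous observations {(Z_j, X_j, Y_j)}_{j<i}, and the final estimate is a measurable function of {(Z_i, X_i, Y_i)}_{i=1}^n), the supremum over all g, f, P_Z, ε_X, ε_Y satisfying the assumptions of P[ |f̂_{x_0} − f(x_0)| ≥ c_1 Φ_{A,*} ] is at least c_2, where Φ_{A,*} := max{ n^{−s_f s_g/d_Z}, (σ_X^{d_X}/n)^{s_f/d_X}, σ_Y/√n, (σ_X^{d_X} σ_Y²/n)^{s_f/(2s_f + d_X)} }. The supremum is over g in the global Hölder ball C^{s_g}(𝒵; 𝒳; L_g) such that g(z_0) = x_0 for some z_0 with P_Z having local dimension d_Z around z_0, f in the global Hölder ball C^{s_f}(𝒳; ℝ; L_f), distributions P_Z, sub-Gaussian ε_X with local dimension d_X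 around 0, and sub-Gaussian ε_Y. -/
open MeasureTheory Filter Metric

noncomputable section

/-- The local Hölder ball `C^s(Z, z₀; X; L)`: functions `g` with
`dist (g z) (g z₀) ≤ L * (dist z z₀)^s` for all `z`. -/
def LocHolderBall {Z X : Type*} [PseudoMetricSpace Z] [PseudoMetricSpace X]
    (s L : ℝ) (z0 : Z) (g : Z → X) : Prop :=
  ∀ z, dist (g z) (g z0) ≤ L * dist z z0 ^ s

/-- The global Hölder ball `C^s(Z; X; L)`. -/
def GlobHolderBall {Z X : Type*} [PseudoMetricSpace Z] [PseudoMetricSpace X]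
    (s L : ℝ) (g : Z → X) : Prop :=
  ∀ z z', dist (g z) (g z') ≤ L * dist z z' ^ s

/-- A measure `P` on a metric space has local dimension `d` around `x`:
`liminf_{r↓0} P(closedBall x r)/r^d > 0`. -/
def HasLocalDim {X : Type*} [PseudoMetricSpace X] [MeasurableSpace X]
    (P : Measure X) (x : X) (d : ℝ) : Prop :=
  0 < liminf (fun r : ℝ => (P (closedBall x r)).toReal / r ^ d) (nhdsWithin 0 (Set.Ioi 0))

/-- A random variable `V` on `(Ω, μ)` has local dimension `d` around `x`. -/
def RVHasLocalDim {Ω X : Type*} [MeasurableSpace Ω] [PseudoMetricSpace X]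
    (μ : Measure Ω) (V : Ω → X) (x : X) (d : ℝ) : Prop :=
  0 < liminf (fun r : ℝ => (μ {ω | dist (V ω) x ≤ r}).toReal / r ^ d)
      (nhdsWithin 0 (Set.Ioi 0))

/-- A probability distribution on `ℝ^d` is sub-Gaussian:
`E[exp⟨x, t⟩] ≤ exp(‖t‖₂²/2)` for all `t`. -/
def SubGaussianVec {d : ℕ} (P : Measure (Fin d → ℝ)) : Prop :=
  ∀ t : Fin d → ℝ, ∫ x, Real.exp (∑ j, x j * t j) ∂P ≤ Real.exp ((∑ j, t j ^ 2) / 2)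

/-- A probability distribution on `ℝ` is sub-Gaussian. -/
def SubGaussianReal (P : Measure ℝ) : Prop :=
  ∀ t : ℝ, ∫ x, Real.exp (x * t) ∂P ≤ Real.exp (t ^ 2 / 2)

/-- `v` is a possible value of the `k`-nearest-neighbor regressor of the data
`(X i, Y i)` at the point `x0`: there is an enumeration of the data ordered by
increasing distance of `X i` to `x0` (ties broken arbitrarily), and `v` is the
average of the responses `Y i` over the first `k` data points. -/
def IsKNNValue {ι : Type*} [Fintype ι] {dX : ℕ} (k : ℕ) (x0 : Fin dX → ℝ)
    (X : ι → Fin dX → ℝ) (Y : ι → ℝ) (v : ℝ) : Prop :=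
  ∃ e : ι ≃ Fin (Fintype.card ι),
    (∀ i j : ι, e i ≤ e j → dist (X i) x0 ≤ dist (X j) x0) ∧
    v = (k : ℝ)⁻¹ * ∑ i : ι, if ((e i : ℕ) < k) then Y i else 0

/-- The cube `[0,1]^m` with the sup metric. -/
abbrev Cube (m : ℕ) := Fin m → Set.Icc (0:ℝ) 1

/-- The standard `d`-dimensional bump function
`K_d(x) = exp(1 - 1/(1 - ‖x‖₂²)) 1{‖x‖₂ < 1}`. -/
def bumpFn (d : ℕ) (x : Fin d → ℝ) : ℝ :=
  if (∑ j, x j ^ 2) < 1 then Real.exp (1 - 1 / (1 - ∑ j, x j ^ 2)) else 0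

/-- The Hölder seminorm `‖f‖_{C^s} = sup_{z ≠ z'} dist (f z) (f z') / dist z z' ^ s`. -/
def holderSeminorm {Z X : Type*} [PseudoMetricSpace Z] [PseudoMetricSpace X]
    (s : ℝ) (f : Z → X) : ℝ :=
  ⨆ p : Z × Z, if dist p.1 p.2 = 0 then 0 else dist (f p.1) (f p.2) / dist p.1 p.2 ^ s


namespace ActiveLowerBound

open ProbabilityTheory Set
open scoped ENNReal NNReal

section Noise

theorem hasLocalDim_of_eventuallyEq {X : Type*} [PseudoMetricSpace X] [MeasurableSpace X]
    {P : Measure X} {x : X} {d : ℕ} {C r₀ : ℝ} (hC : 0 < C) (hr₀ : 0 < r₀)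
    (h : ∀ r, 0 < r → r < r₀ → P (closedBall x r) = ENNReal.ofReal (C * r) ^ d) :
    HasLocalDim P x (d : ℝ) := by
  have hev : (fun r : ℝ => (P (closedBall x r)).toReal / r ^ (d : ℝ))
      =ᶠ[nhdsWithin 0 (Ioi 0)] fun _ => C ^ d := by
    filter_upwards [Ioo_mem_nhdsGT hr₀] with r hr
    have hr' : 0 < r := hr.1
    rw [h r hr.1 hr.2, Real.rpow_natCast, ENNReal.toReal_pow,
      ENNReal.toReal_ofReal (by positivity), mul_pow]
    field_simp
  rw [HasLocalDim, liminf_congr hev, liminf_const]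
  positivity

/-- The uniform distribution on `[-a, a]`. -/
def unifReal (a : ℝ) : Measure ℝ := volume[|Icc (-a) a]

/-- The uniform distribution on `[-a, a]^d`. -/
def unifCube (d : ℕ) (a : ℝ) : Measure (Fin d → ℝ) := Measure.pi fun _ => unifReal a

theorem isProbabilityMeasure_unifReal {a : ℝ} (ha : 0 < a) :
    IsProbabilityMeasure (unifReal a) := by
  refine cond_isProbabilityMeasure_of_finite ?_ ?_ <;> simp [ha]

theorem isProbabilityMeasure_unifCube (d : ℕ) {a : ℝ} (ha : 0 < a) :
    IsProbabilityMeasure (unifCube d a) := by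
  have := isProbabilityMeasure_unifReal ha
  unfold unifCube; infer_instance

theorem ae_unifReal (a : ℝ) : ∀ᵐ x ∂unifReal a, x ∈ Icc (-a) a :=
  ae_cond_mem measurableSet_Icc

theorem unifReal_closedBall_le {a r : ℝ} (ha : 0 < a) :
    unifReal a (closedBall 0 r) ≤ ENNReal.ofReal (a⁻¹ * r) := by
  rw [unifReal, cond_apply measurableSet_Icc, Real.volume_Icc,
    ← ENNReal.ofReal_inv_of_pos (by linarith)]
  calc _ ≤ ENNReal.ofReal (a - -a)⁻¹ * volume (closedBall (0 : ℝ) r) := by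
        gcongr; exact inter_subset_right
    _ = _ := by
        rw [Real.volume_closedBall, ← ENNReal.ofReal_mul (by rw [inv_nonneg]; linarith)]
        congr 1
        field_simp
        ring

theorem unifReal_closedBall {a r : ℝ} (ha : 0 < a) (hr : r ≤ a) :
    unifReal a (closedBall 0 r) = ENNReal.ofReal (a⁻¹ * r) := by
  have hsub : closedBall (0 : ℝ) r ⊆ Icc (-a) a := by
    rw [Real.closedBall_eq_Icc]
    exact Icc_subset_Icc (by linarith) (by linarith)
  rw [unifReal, cond_apply measurableSet_Icc, Real.volume_Icc, inter_eq_self_of_subset_right hsub,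
    ← ENNReal.ofReal_inv_of_pos (by linarith), Real.volume_closedBall,
    ← ENNReal.ofReal_mul (by rw [inv_nonneg]; linarith)]
  congr 1
  field_simp
  ring

theorem integral_id_unifReal (a : ℝ) (ha : 0 < a) : ∫ x, x ∂unifReal a = 0 := by
  rw [unifReal, ProbabilityTheory.cond, integral_smul_measure, integral_Icc_eq_integral_Ioc,
    ← intervalIntegral.integral_of_le (by linarith), integral_id]
  simp

theorem subGaussianReal_unifReal {a : ℝ} (ha : 0 < a) (ha1 : a ≤ 1) :
    SubGaussianReal (unifReal a) := by
  have := isProbabilityMeasure_unifReal ha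
  intro t
  have h := (hasSubgaussianMGF_of_mem_Icc_of_integral_eq_zero (μ := unifReal a) (X := id)
    aemeasurable_id (ae_unifReal a) (integral_id_unifReal a ha)).mgf_le t
  simp only [mgf, id, mul_comm t] at h
  refine h.trans (Real.exp_le_exp.2 ?_)
  have hc : ((((‖a - -a‖₊ / 2) ^ 2 : ℝ≥0)) : ℝ) = a ^ 2 := by
    push_cast
    rw [Real.norm_eq_abs, abs_of_pos (by linarith)]
    ring
  rw [hc]
  nlinarith [mul_le_mul_of_nonneg_right (pow_le_one₀ ha.le ha1 : a ^ 2 ≤ 1) (sq_nonneg t)]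

theorem unifCube_closedBall_le (d : ℕ) {a r : ℝ} (ha : 0 < a) (hr : 0 ≤ r) :
    unifCube d a (closedBall 0 r) ≤ ENNReal.ofReal (a⁻¹ * r) ^ d := by
  have := isProbabilityMeasure_unifReal ha
  rw [unifCube, Measure.pi_closedBall _ _ hr]
  refine (Finset.prod_le_prod' fun i _ => unifReal_closedBall_le ha).trans ?_
  simp

theorem hasLocalDim_unifCube (d : ℕ) {a : ℝ} (ha : 0 < a) :
    HasLocalDim (unifCube d a) 0 (d : ℝ) := by
  have := isProbabilityMeasure_unifReal ha
  refine hasLocalDim_of_eventuallyEq (inv_pos.2 ha) ha fun r hr hra => ?_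
  rw [unifCube, Measure.pi_closedBall _ _ hr.le]
  simp [unifReal_closedBall ha hra.le]

theorem ae_unifCube (d : ℕ) {a : ℝ} (ha : 0 < a) : ∀ᵐ x ∂unifCube d a, ‖x‖ ≤ a := by
  have := isProbabilityMeasure_unifReal ha
  have h : ∀ j, ∀ᵐ x ∂unifCube d a, x j ∈ Icc (-a) a := fun j =>
    (measurePreserving_eval (fun _ : Fin d => unifReal a) j).quasiMeasurePreserving.ae
      (ae_unifReal a)
  filter_upwards [ae_all_iff.2 h] with x hx
  refine (pi_norm_le_iff_of_nonneg ha.le).2 fun j => ?_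
  exact abs_le.2 (hx j)

theorem integral_unifCube (d : ℕ) {a : ℝ} (ha : 0 < a) (j : Fin d) :
    ∫ x, x j ∂unifCube d a = 0 := by
  have := isProbabilityMeasure_unifReal ha
  rw [← integral_id_unifReal a ha,
    ← (measurePreserving_eval (fun _ : Fin d => unifReal a) j).map_eq,
    integral_map (measurable_pi_apply j).aemeasurable (by fun_prop)]
  rfl

theorem subGaussianVec_unifCube (d : ℕ) {a : ℝ} (ha : 0 < a) (ha1 : a ≤ 1) :
    SubGaussianVec (unifCube d a) := by
  have := isProbabilityMeasure_unifReal ha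
  intro t
  simp only [Real.exp_sum, Finset.sum_div]
  rw [unifCube, integral_fintype_prod_eq_prod (𝕜 := ℝ) (fun j x => Real.exp (x * t j))]
  exact Finset.prod_le_prod (fun j _ => integral_nonneg fun x => (Real.exp_pos _).le)
    fun j _ => subGaussianReal_unifReal ha ha1 (t j)

theorem subGaussianReal_gaussianReal : SubGaussianReal (gaussianReal 0 1) := by
  intro t
  have h := mgf_gaussianReal (p := gaussianReal 0 1) (X := id) (μ := 0) (v := 1) (by simp) t
  simp only [mgf, id, mul_comm t] at h
  rw [h]
  simp

theorem hasLocalDim_volume_cube (d : ℕ) (z : Cube d)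
    {r₀ : ℝ} (hr₀ : 0 < r₀) (hz : ∀ j, r₀ ≤ (z j : ℝ) ∧ (z j : ℝ) ≤ 1 - r₀) :
    HasLocalDim (volume : Measure (Fin d → unitInterval)) z (d : ℝ) := by
  refine hasLocalDim_of_eventuallyEq (C := 2) two_pos hr₀ fun r hr hrr => ?_
  rw [volume_pi_closedBall _ hr.le]
  have h : ∀ j, (volume : Measure unitInterval) (closedBall (z j) r)
      = ENNReal.ofReal (2 * r) := fun j => by
    have hset : (Subtype.val '' (closedBall (z j) r : Set unitInterval)) =
        closedBall (z j : ℝ) r := by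
      ext x
      constructor
      · rintro ⟨y, hy, rfl⟩
        exact hy
      · intro hx
        have hx' := hx
        rw [Real.closedBall_eq_Icc] at hx'
        have := hz j
        exact ⟨⟨x, by linarith [hx'.1], by linarith [hx'.2]⟩, hx, rfl⟩
    rw [unitInterval.volume_apply, hset, Real.volume_closedBall]
  simp [h]

end Noise

section ChangeOfMeasure

variable {α β : Type*} [MeasurableSpace α] [MeasurableSpace β]

/-- `ν` has a density with respect to `μ` whose second moment is at most `M`, expressed through
the Cauchy-Schwarz inequality this entails. -/
def L2Dominated (M : ℝ≥0∞) (ν μ : Measure α) : Prop :=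
  ∀ F : α → ℝ≥0∞, Measurable F → (∫⁻ x, F x ∂ν) ^ 2 ≤ M * ∫⁻ x, F x ^ 2 ∂μ

theorem sq_lintegral_mul_le (μ : Measure α) {F L : α → ℝ≥0∞} (hF : Measurable F)
    (hL : Measurable L) :
    (∫⁻ x, F x * L x ∂μ) ^ 2 ≤ (∫⁻ x, L x ^ 2 ∂μ) * ∫⁻ x, F x ^ 2 ∂μ := by
  have h := ENNReal.lintegral_mul_le_Lp_mul_Lq μ Real.HolderConjugate.two_two
    hF.aemeasurable hL.aemeasurable
  have hsq : ∀ y : ℝ≥0∞, (y ^ (1 / 2 : ℝ)) ^ 2 = y := fun y => by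
    rw [← ENNReal.rpow_natCast, ← ENNReal.rpow_mul]; norm_num
  calc _ ≤ _ := pow_le_pow_left' h 2
    _ = _ := by
      rw [mul_pow, hsq, hsq, mul_comm]
      simp

theorem L2Dominated.refl (μ : Measure α) [IsProbabilityMeasure μ] : L2Dominated 1 μ μ := by
  intro F hF
  simpa using sq_lintegral_mul_le μ hF (measurable_const (a := (1 : ℝ≥0∞)))

theorem L2Dominated.prod {M₁ M₂ : ℝ≥0∞} {ν₁ μ₁ : Measure α} {ν₂ μ₂ : Measure β}
    [SFinite ν₁] [SFinite μ₁] [SFinite ν₂] [SFinite μ₂]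
    (h₁ : L2Dominated M₁ ν₁ μ₁) (h₂ : L2Dominated M₂ ν₂ μ₂) :
    L2Dominated (M₁ * M₂) (ν₁.prod ν₂) (μ₁.prod μ₂) := by
  intro F hF
  rw [lintegral_prod _ hF.aemeasurable, lintegral_prod _ (hF.pow_const 2).aemeasurable]
  calc (∫⁻ x, ∫⁻ y, F (x, y) ∂ν₂ ∂ν₁) ^ 2
      ≤ M₁ * ∫⁻ x, (∫⁻ y, F (x, y) ∂ν₂) ^ 2 ∂μ₁ := h₁ _ hF.lintegral_prod_right'
    _ ≤ M₁ * ∫⁻ x, M₂ * ∫⁻ y, F (x, y) ^ 2 ∂μ₂ ∂μ₁ := by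
        gcongr with x
        exact h₂ _ (hF.comp measurable_prodMk_left)
    _ = _ := by
        rw [lintegral_const_mul _ (hF.pow_const 2).lintegral_prod_right', mul_assoc]

theorem L2Dominated.of_measurePreserving {M : ℝ≥0∞} {ν μ : Measure α} {ν' μ' : Measure β}
    (h : L2Dominated M ν μ) {φ : α → β} (hν : MeasurePreserving φ ν ν')
    (hμ : MeasurePreserving φ μ μ') : L2Dominated M ν' μ' := by
  intro F hF
  rw [← hν.lintegral_comp hF, ← hμ.lintegral_comp (hF.pow_const 2)]
  exact h _ (hF.comp hν.measurable)

theorem L2Dominated.pi {M : ℝ≥0∞} {ν μ : Measure α} [SigmaFinite ν] [SigmaFinite μ]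
    (h : L2Dominated M ν μ) (n : ℕ) :
    L2Dominated (M ^ n) (Measure.pi fun _ : Fin n => ν) (Measure.pi fun _ : Fin n => μ) := by
  induction n with
  | zero =>
    intro F hF
    rw [Measure.pi_of_empty _ (fun i => i.elim0), Measure.pi_of_empty _ (fun i => i.elim0)]
    simp [lintegral_dirac' _ hF, lintegral_dirac' _ (hF.pow_const 2)]
  | succ n ih =>
    rw [pow_succ']
    exact (h.prod ih).of_measurePreserving
      (measurePreserving_piFinSuccAbove (fun _ : Fin (n + 1) => ν) 0).symm
      (measurePreserving_piFinSuccAbove (fun _ : Fin (n + 1) => μ) 0).symm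

theorem L2Dominated.measure_preimage_le {M : ℝ≥0∞} {ν μ : Measure α} (h : L2Dominated M ν μ)
    {τ : α → α} (hτ : MeasurePreserving τ μ ν) (s : Set α) :
    μ (τ ⁻¹' s) ^ 2 ≤ M * μ s := by
  have hm := measurableSet_toMeasurable μ s
  have h' := h ((toMeasurable μ s).indicator 1) (measurable_one.indicator hm)
  have hsq : ∀ x, (toMeasurable μ s).indicator (1 : α → ℝ≥0∞) x ^ 2 =
      (toMeasurable μ s).indicator 1 x := fun x => by
    by_cases hx : x ∈ toMeasurable μ s <;> simp [hx]
  simp only [hsq, lintegral_indicator_one hm, measure_toMeasurable] at h'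
  refine le_trans (pow_le_pow_left' ?_ 2) h'
  rw [← hτ.measure_preimage hm.nullMeasurableSet]
  exact measure_mono (preimage_mono (subset_toMeasurable μ s))

theorem lintegral_gaussianReal_add (m : ℝ) {F : ℝ → ℝ≥0∞} (hF : Measurable F) :
    ∫⁻ y, F (y + m) ∂gaussianReal 0 1 =
      ∫⁻ y, F y * ENNReal.ofReal (Real.exp (m * y - m ^ 2 / 2)) ∂gaussianReal 0 1 := by
  rw [← lintegral_map hF (measurable_add_const m), gaussianReal_map_add_const,
    gaussianReal_of_var_ne_zero _ one_ne_zero, gaussianReal_of_var_ne_zero _ one_ne_zero,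
    lintegral_withDensity_eq_lintegral_mul _ (measurable_gaussianPDF _ _) hF,
    lintegral_withDensity_eq_lintegral_mul _ (measurable_gaussianPDF _ _) (by fun_prop)]
  refine lintegral_congr fun y => ?_
  simp only [Pi.mul_apply, gaussianPDF]
  rw [mul_left_comm, ← ENNReal.ofReal_mul (gaussianPDFReal_nonneg _ _ _), mul_comm]
  congr 2
  simp only [gaussianPDFReal, mul_assoc, ← Real.exp_add]
  congr 2
  push_cast
  ring

theorem lintegral_exp_sq_gaussianReal (m : ℝ) :
    ∫⁻ y, ENNReal.ofReal (Real.exp (m * y - m ^ 2 / 2)) ^ 2 ∂gaussianReal 0 1 =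
      ENNReal.ofReal (Real.exp (m ^ 2)) := by
  have h : ∀ y : ℝ, ENNReal.ofReal (Real.exp (m * y - m ^ 2 / 2)) ^ 2 =
      ENNReal.ofReal (Real.exp (m ^ 2)) *
        ((fun _ => 1 : ℝ → ℝ≥0∞) y *
          ENNReal.ofReal (Real.exp ((2 * m) * y - (2 * m) ^ 2 / 2))) := fun y => by
    rw [← ENNReal.ofReal_pow (Real.exp_pos _).le, one_mul,
      ← ENNReal.ofReal_mul (Real.exp_pos _).le, ← Real.exp_add, ← Real.exp_nat_mul]
    congr 2
    push_cast
    ring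
  simp only [h]
  rw [lintegral_const_mul _ (by fun_prop),
    ← lintegral_gaussianReal_add (2 * m) (F := fun _ => 1) measurable_const]
  simp

theorem measurable_shear {m : α → ℝ} (hm : Measurable m) :
    Measurable fun p : α × ℝ => (p.1, p.2 + m p.1) := by fun_prop

theorem l2Dominated_map_shear (P : Measure α) [IsProbabilityMeasure P] {m : α → ℝ}
    (hm : Measurable m) :
    L2Dominated (∫⁻ x, ENNReal.ofReal (Real.exp (m x ^ 2)) ∂P)
      ((P.prod (gaussianReal 0 1)).map fun p => (p.1, p.2 + m p.1))
      (P.prod (gaussianReal 0 1)) := by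
  intro F hF
  have hL : Measurable fun p : α × ℝ =>
      ENNReal.ofReal (Real.exp (m p.1 * p.2 - m p.1 ^ 2 / 2)) := by fun_prop
  have hFL : Measurable fun p : α × ℝ =>
      F p * ENNReal.ofReal (Real.exp (m p.1 * p.2 - m p.1 ^ 2 / 2)) := hF.mul hL
  have hFs : Measurable fun p : α × ℝ => F (p.1, p.2 + m p.1) := hF.comp (measurable_shear hm)
  rw [lintegral_map hF (measurable_shear hm), lintegral_prod _ hFs.aemeasurable]
  have h := sq_lintegral_mul_le (P.prod (gaussianReal 0 1)) hF hL
  rw [lintegral_prod _ hFL.aemeasurable,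
    lintegral_prod _ (hL.pow_const 2).aemeasurable] at h
  simp only [lintegral_exp_sq_gaussianReal] at h
  convert h using 4 with x
  exact lintegral_gaussianReal_add (m x) (hF.comp measurable_prodMk_left)

end ChangeOfMeasure

section Hoelder

theorem abs_rpow_sub_rpow_le {s a b : ℝ} (hs : s ∈ Ioc (0 : ℝ) 1) (ha : 0 ≤ a) (hb : 0 ≤ b) :
    |a ^ s - b ^ s| ≤ |a - b| ^ s := by
  have key : ∀ {a b : ℝ}, 0 ≤ a → a ≤ b → |a ^ s - b ^ s| ≤ |a - b| ^ s := by
    intro a b ha hab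
    have h := Real.rpow_add_le_add_rpow ha (sub_nonneg.2 hab) hs.1.le hs.2
    have h' := Real.rpow_le_rpow ha hab hs.1.le
    rw [add_sub_cancel] at h
    rw [abs_sub_comm, abs_of_nonneg (by linarith), abs_sub_comm, abs_of_nonneg (by linarith)]
    linarith
  rcases le_total a b with hab | hab
  · exact key ha hab
  · rw [abs_sub_comm, abs_sub_comm a]
    exact key hb hab

theorem abs_dist_rpow_sub_le {Z : Type*} [PseudoMetricSpace Z] {s : ℝ} (hs : s ∈ Ioc (0 : ℝ) 1)
    (z₀ z z' : Z) : |dist z z₀ ^ s - dist z' z₀ ^ s| ≤ dist z z' ^ s :=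
  (abs_rpow_sub_rpow_le hs dist_nonneg dist_nonneg).trans <|
    Real.rpow_le_rpow (abs_nonneg _) (abs_dist_sub_le z z' z₀) hs.1.le

theorem globHolderBall_const {Z X : Type*} [PseudoMetricSpace Z] [PseudoMetricSpace X]
    (s : ℝ) {L : ℝ} (hL : 0 ≤ L) (x : X) : GlobHolderBall s L (fun _ : Z => x) := by
  intro z z'
  rw [dist_self]
  positivity

/-- The cusp of height `κ * h ^ s` at `x₀` which vanishes at distance at least `h`. -/
def spike {X : Type*} [PseudoMetricSpace X] (κ h s : ℝ) (x₀ x : X) : ℝ :=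
  max 0 (κ * (h ^ s - dist x x₀ ^ s))

section Spike

variable {X : Type*} [PseudoMetricSpace X] {κ h s L : ℝ}

theorem globHolderBall_spike (hs : s ∈ Ioc (0 : ℝ) 1) (hκ : 0 ≤ κ) (hκL : κ ≤ L) (x₀ : X) :
    GlobHolderBall s L (spike κ h s x₀) := by
  intro x x'
  rw [Real.dist_eq, spike, spike]
  calc _ ≤ |κ * (h ^ s - dist x x₀ ^ s) - κ * (h ^ s - dist x' x₀ ^ s)| := by
        rw [max_comm 0, max_comm 0]
        exact abs_max_sub_max_le_abs _ _ _
    _ = κ * |dist x' x₀ ^ s - dist x x₀ ^ s| := by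
        rw [← mul_sub, abs_mul, abs_of_nonneg hκ]
        congr 2
        ring
    _ ≤ κ * dist x x' ^ s := by
        gcongr
        rw [dist_comm x x']
        exact abs_dist_rpow_sub_le hs x₀ x' x
    _ ≤ _ := by gcongr

theorem spike_eq_zero (hs : 0 ≤ s) (hκ : 0 ≤ κ) (hh : 0 ≤ h) {x₀ x : X} (hx : h ≤ dist x x₀) :
    spike κ h s x₀ x = 0 :=
  max_eq_left <| mul_nonpos_of_nonneg_of_nonpos hκ <|
    sub_nonpos.2 <| Real.rpow_le_rpow hh hx hs

theorem spike_self (hs : 0 < s) (hκ : 0 ≤ κ) (hh : 0 ≤ h) (x₀ : X) :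
    spike κ h s x₀ x₀ = κ * h ^ s := by
  rw [spike, dist_self, Real.zero_rpow hs.ne', sub_zero]
  exact max_eq_right (by positivity)

theorem spike_nonneg (x₀ x : X) : 0 ≤ spike κ h s x₀ x := le_max_left _ _

theorem spike_le (hκ : 0 ≤ κ) (hh : 0 ≤ h) (x₀ x : X) : spike κ h s x₀ x ≤ κ * h ^ s := by
  refine max_le (by positivity) ?_
  gcongr
  exact sub_le_self _ (by positivity)

end Spike

/-- The map equal to `x₀` at `z₀` and pushed away from `x₀` by `c * ρ ^ s` at distance at
least `ρ` from `z₀`. -/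
def dip {Z : Type*} [PseudoMetricSpace Z] {d : ℕ} (c ρ s : ℝ) (z₀ : Z) (x₀ : Fin d → ℝ) (z : Z) :
    Fin d → ℝ :=
  x₀ + fun _ => c * min (ρ ^ s) (dist z z₀ ^ s)

section Dip

variable {Z : Type*} [PseudoMetricSpace Z] {d : ℕ} {c ρ s : ℝ}

theorem globHolderBall_dip (hs : s ∈ Ioc (0 : ℝ) 1) (hc : 0 ≤ c) (z₀ : Z) (x₀ : Fin d → ℝ) :
    GlobHolderBall s c (dip c ρ s z₀ x₀) := by
  intro z z'
  refine (dist_pi_le_iff (by positivity)).2 fun j => ?_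
  simp only [dip, Pi.add_apply, dist_add_left, Real.dist_eq]
  rw [← mul_sub, abs_mul, abs_of_nonneg hc]
  gcongr
  refine le_trans ?_ (abs_dist_rpow_sub_le hs z₀ z z')
  simpa using abs_min_sub_min_le_max (ρ ^ s) (dist z z₀ ^ s) (ρ ^ s) (dist z' z₀ ^ s)

theorem dip_self (hs : 0 < s) (hρ : 0 ≤ ρ) (z₀ : Z) (x₀ : Fin d → ℝ) :
    dip c ρ s z₀ x₀ z₀ = x₀ := by
  have : min (ρ ^ s) (0 : ℝ) = 0 := min_eq_right (by positivity)
  ext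
  simp [dip, Real.zero_rpow hs.ne', this]

theorem dip_of_le (hs : 0 ≤ s) (hρ : 0 ≤ ρ) {z₀ z : Z} (x₀ : Fin d → ℝ) (hz : ρ ≤ dist z z₀) :
    dip c ρ s z₀ x₀ z = x₀ + fun _ => c * ρ ^ s := by
  rw [dip, min_eq_left (Real.rpow_le_rpow hρ hz hs)]

end Dip

end Hoelder

section Path

variable {n : ℕ} {D : Type*}

theorem path_unique {R R' : (i : Fin n) → (Fin (i : ℕ) → D) → D} {d d' : Fin n → D}
    (hd : ∀ i, d i = R i fun j => d ⟨j, j.2.trans i.2⟩)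
    (hd' : ∀ i, d' i = R' i fun j => d' ⟨j, j.2.trans i.2⟩)
    (h : ∀ i, R i (fun j => d ⟨j, j.2.trans i.2⟩) = R' i fun j => d ⟨j, j.2.trans i.2⟩) :
    d = d' := by
  have key : ∀ m (hm : m < n), d ⟨m, hm⟩ = d' ⟨m, hm⟩ := by
    intro m
    induction m using Nat.strong_induction_on with
    | _ m ih =>
      intro hm
      rw [hd, hd', h]
      congr 1
      funext j
      exact ih j j.2 _
  exact funext fun i => key i i.2

theorem path_exists [Nonempty D] (R : (i : Fin n) → (Fin (i : ℕ) → D) → D) :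
    ∃ d : Fin n → D, ∀ i, d i = R i fun j => d ⟨j, j.2.trans i.2⟩ := by
  have key : ∀ m, ∃ d : Fin n → D,
      ∀ i : Fin n, (i : ℕ) < m → d i = R i fun j => d ⟨j, j.2.trans i.2⟩ := by
    intro m
    induction m with
    | zero => exact ⟨fun _ => Classical.arbitrary D, fun i hi => absurd hi (Nat.not_lt_zero _)⟩
    | succ m ih =>
      obtain ⟨d, hd⟩ := ih
      refine ⟨fun i => if (i : ℕ) < m then d i else R i fun j => d ⟨j, j.2.trans i.2⟩,
        fun i hi => ?_⟩
      have hpast : (fun j : Fin (i : ℕ) => if (j : ℕ) < m then d ⟨j, j.2.trans i.2⟩ else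
          R ⟨j, j.2.trans i.2⟩ fun k => d ⟨k, k.2.trans (j.2.trans i.2)⟩) =
          fun j : Fin (i : ℕ) => d ⟨j, j.2.trans i.2⟩ := by
        funext j
        exact if_pos (by omega)
      dsimp only
      rw [hpast]
      split_ifs with him
      · exact hd i him
      · rfl
  obtain ⟨d, hd⟩ := key n
  exact ⟨d, fun i => hd i i.2⟩

end Path

section Experiment

/-- A triple consisting of a query, the covariate, and the response. -/
abbrev Obs (dX dZ : ℕ) := Cube dZ × (Fin dX → ℝ) × ℝ

variable {n dX dZ : ℕ} {U : Type}

/-- The next observation, as a function of the past ones and of the noise `e`. -/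
def step (ζ : (i : Fin n) → (Fin (i : ℕ) → Obs dX dZ) → U → Cube dZ) (σX σY : ℝ)
    (g : Cube dZ → Fin dX → ℝ) (f : (Fin dX → ℝ) → ℝ) (ω : U × (Fin n → (Fin dX → ℝ) × ℝ))
    (i : Fin n) (past : Fin (i : ℕ) → Obs dX dZ) : Obs dX dZ :=
  (ζ i past ω.1, g (ζ i past ω.1) + σX • (ω.2 i).1,
    f (g (ζ i past ω.1) + σX • (ω.2 i).1) + σY * (ω.2 i).2)

/-- The dataset `d` is generated by the procedure `ζ` in the model `(g, f)` with noise `ω`. -/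
def IsPath (ζ : (i : Fin n) → (Fin (i : ℕ) → Obs dX dZ) → U → Cube dZ) (σX σY : ℝ)
    (g : Cube dZ → Fin dX → ℝ) (f : (Fin dX → ℝ) → ℝ) (ω : U × (Fin n → (Fin dX → ℝ) × ℝ))
    (d : Fin n → Obs dX dZ) : Prop :=
  ∀ i, d i = step ζ σX σY g f ω i fun j => d ⟨j, j.2.trans i.2⟩

variable [MeasurableSpace U]

/-- The joint law of the internal randomization and of the noise. -/
def expLaw (n dX : ℕ) (PU : Measure U) (a : ℝ) :
    Measure (U × (Fin n → (Fin dX → ℝ) × ℝ)) :=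
  PU.prod (Measure.pi fun _ => (unifCube dX a).prod (gaussianReal 0 1))

theorem isProbabilityMeasure_expLaw (n dX : ℕ) (PU : Measure U) [IsProbabilityMeasure PU]
    {a : ℝ} (ha : 0 < a) : IsProbabilityMeasure (expLaw n dX PU a) := by
  have := isProbabilityMeasure_unifCube dX ha
  unfold expLaw
  infer_instance

theorem measurePreserving_expLaw (PU : Measure U) [IsProbabilityMeasure PU] {a : ℝ} (ha : 0 < a)
    (i : Fin n) : MeasurePreserving (fun ω : U × (Fin n → (Fin dX → ℝ) × ℝ) => (ω.2 i).1)
      (expLaw n dX PU a) (unifCube dX a) := by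
  have := isProbabilityMeasure_unifCube dX ha
  exact (measurePreserving_fst.comp (measurePreserving_eval
    (fun _ : Fin n => (unifCube dX a).prod (gaussianReal 0 1)) i)).comp measurePreserving_snd

/-- Every dataset generated in the model `(g, f)`, with uniform noise on `[-a, a]^dX` for the
covariates and Gaussian noise for the responses, has error at least `δ` with probability at
least `1 / 100`. -/
def HasRisk (ζ : (i : Fin n) → (Fin (i : ℕ) → Obs dX dZ) → U → Cube dZ)
    (est : (Fin n → Obs dX dZ) → U → ℝ) (PU : Measure U) (x₀ : Fin dX → ℝ) (σX σY : ℝ)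
    (g : Cube dZ → Fin dX → ℝ) (f : (Fin dX → ℝ) → ℝ) (a δ : ℝ) : Prop :=
  ∀ D : U × (Fin n → (Fin dX → ℝ) × ℝ) → Fin n → Obs dX dZ, (∀ ω, IsPath ζ σX σY g f ω (D ω)) →
    ENNReal.ofReal (1 / 100) ≤ expLaw n dX PU a {ω | δ ≤ |est (D ω) ω.1 - f x₀|}

variable {ζ : (i : Fin n) → (Fin (i : ℕ) → Obs dX dZ) → U → Cube dZ}
  {est : (Fin n → Obs dX dZ) → U → ℝ} {PU : Measure U} {x₀ : Fin dX → ℝ} {σX σY : ℝ}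
  {g : Cube dZ → Fin dX → ℝ} {f : (Fin dX → ℝ) → ℝ} {a δ : ℝ}

theorem HasRisk.mono {δ' : ℝ} (h : HasRisk ζ est PU x₀ σX σY g f a δ) (hδ : δ' ≤ δ) :
    HasRisk ζ est PU x₀ σX σY g f a δ' := fun D hD =>
  (h D hD).trans <| measure_mono fun _ hω => hδ.trans hω

theorem exists_path_of_not_hasRisk (h : ¬ HasRisk ζ est PU x₀ σX σY g f a δ) :
    ∃ D : U × (Fin n → (Fin dX → ℝ) × ℝ) → Fin n → Obs dX dZ,
      (∀ ω, IsPath ζ σX σY g f ω (D ω)) ∧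
      expLaw n dX PU a {ω | δ ≤ |est (D ω) ω.1 - f x₀|} < ENNReal.ofReal (1 / 100) := by
  simpa only [HasRisk, not_forall, not_le, exists_prop] using h

theorem le_abs_sub_or_le_abs_sub {δ θ₀ θ₁ t : ℝ} (h : 2 * δ ≤ θ₁ - θ₀) :
    δ ≤ |t - θ₀| ∨ δ ≤ |t - θ₁| := by
  by_contra! hlt
  have h₀ := abs_lt.1 hlt.1
  have h₁ := abs_lt.1 hlt.2
  linarith

/-- Separation of two models whose covariates rarely reveal the difference of the regression
functions. -/
theorem hasRisk_or_of_rarely_distinct [IsProbabilityMeasure PU] (ha : 0 < a) {f₁ : (Fin dX → ℝ) → ℝ}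
    {r : ℝ} (hr : (n : ℝ≥0∞) * unifCube dX a (closedBall 0 r) ≤ ENNReal.ofReal (1 / 2))
    (hf₁ : ∀ e : Fin dX → ℝ, r < ‖e‖ → f₁ (x₀ + σX • e) = 0) :
    HasRisk ζ est PU x₀ σX σY (fun _ => x₀) (fun _ => 0) a (f₁ x₀ / 2) ∨
      HasRisk ζ est PU x₀ σX σY (fun _ => x₀) f₁ a (f₁ x₀ / 2) := by
  by_contra hcon
  rw [not_or] at hcon
  obtain ⟨D₀, hD₀, hE₀⟩ := exists_path_of_not_hasRisk hcon.1
  obtain ⟨D₁, hD₁, hE₁⟩ := exists_path_of_not_hasRisk hcon.2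
  have := isProbabilityMeasure_expLaw n dX PU ha
  set E₀ := {ω : U × (Fin n → (Fin dX → ℝ) × ℝ) | f₁ x₀ / 2 ≤ |est (D₀ ω) ω.1 - 0|}
  set E₁ := {ω : U × (Fin n → (Fin dX → ℝ) × ℝ) | f₁ x₀ / 2 ≤ |est (D₁ ω) ω.1 - f₁ x₀|}
  set B := ⋃ i : Fin n, (fun ω : U × (Fin n → (Fin dX → ℝ) × ℝ) => (ω.2 i).1) ⁻¹'
    closedBall (0 : Fin dX → ℝ) r
  have hB : expLaw n dX PU a B ≤ ENNReal.ofReal (1 / 2) := by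
    refine (measure_iUnion_fintype_le _ _).trans (le_trans (le_of_eq ?_) hr)
    simp [(measurePreserving_expLaw PU ha _).measure_preimage
      measurableSet_closedBall.nullMeasurableSet]
  have hcover : (univ : Set (U × (Fin n → (Fin dX → ℝ) × ℝ))) ⊆ E₀ ∪ E₁ ∪ B := by
    intro ω _
    by_cases hω : ω ∈ B
    · exact Or.inr hω
    · left
      have hfar : ∀ i, r < ‖(ω.2 i).1‖ := fun i => by
        by_contra! hi
        exact hω (mem_iUnion.2 ⟨i, by simpa using hi⟩)
      have heq : D₀ ω = D₁ ω := path_unique (hD₀ ω) (hD₁ ω) fun i => by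
        simp only [step, hf₁ _ (hfar i)]
      change f₁ x₀ / 2 ≤ |est (D₀ ω) ω.1 - 0| ∨ f₁ x₀ / 2 ≤ |est (D₁ ω) ω.1 - f₁ x₀|
      rw [heq]
      exact le_abs_sub_or_le_abs_sub (by linarith)
  have h1 : (1 : ℝ≥0∞) ≤ ENNReal.ofReal (1 / 100) + ENNReal.ofReal (1 / 100) +
      ENNReal.ofReal (1 / 2) := by
    rw [← measure_univ (μ := expLaw n dX PU a)]
    refine (measure_mono hcover).trans ((measure_union_le _ _).trans (add_le_add ?_ hB))
    exact (measure_union_le _ _).trans (add_le_add hE₀.le hE₁.le)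
  rw [← ENNReal.ofReal_add (by norm_num) (by norm_num),
    ← ENNReal.ofReal_add (by norm_num) (by norm_num), ENNReal.one_le_ofReal] at h1
  norm_num at h1

/-- Separation of two models whose responses have close distributions. -/
theorem hasRisk_or_of_lintegral_le [IsProbabilityMeasure PU] (ha : 0 < a) (hn : 0 < n)
    (hσY : 0 < σY) {f₁ : (Fin dX → ℝ) → ℝ} (hf₁ : Measurable f₁)
    (hint : ∫⁻ e, ENNReal.ofReal (Real.exp ((f₁ (x₀ + σX • e) / σY) ^ 2)) ∂unifCube dX a ≤
      ENNReal.ofReal (Real.exp (2 / n))) :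
    HasRisk ζ est PU x₀ σX σY (fun _ => x₀) (fun _ => 0) a (f₁ x₀ / 2) ∨
      HasRisk ζ est PU x₀ σX σY (fun _ => x₀) f₁ a (f₁ x₀ / 2) := by
  by_contra hcon
  rw [not_or] at hcon
  obtain ⟨D₀, hD₀, hE₀⟩ := exists_path_of_not_hasRisk hcon.1
  obtain ⟨D₁, hD₁, hE₁⟩ := exists_path_of_not_hasRisk hcon.2
  have := isProbabilityMeasure_expLaw n dX PU ha
  have := isProbabilityMeasure_unifCube dX ha
  set E₀ := {ω : U × (Fin n → (Fin dX → ℝ) × ℝ) | f₁ x₀ / 2 ≤ |est (D₀ ω) ω.1 - 0|}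
  set E₁ := {ω : U × (Fin n → (Fin dX → ℝ) × ℝ) | f₁ x₀ / 2 ≤ |est (D₁ ω) ω.1 - f₁ x₀|}
  set m : (Fin dX → ℝ) → ℝ := fun e => f₁ (x₀ + σX • e) / σY
  have hm : Measurable m := by fun_prop
  set shear : (Fin dX → ℝ) × ℝ → (Fin dX → ℝ) × ℝ := fun p => (p.1, p.2 + m p.1)
  have hshear : Measurable shear := measurable_shear hm
  set μ₁ := (unifCube dX a).prod (gaussianReal 0 1)
  have : IsProbabilityMeasure (μ₁.map shear) :=
    Measure.isProbabilityMeasure_map hshear.aemeasurable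
  set τ : U × (Fin n → (Fin dX → ℝ) × ℝ) → U × (Fin n → (Fin dX → ℝ) × ℝ) :=
    Prod.map id fun e i => shear (e i)
  have hτ : MeasurePreserving τ (expLaw n dX PU a)
      (PU.prod (Measure.pi fun _ => μ₁.map shear)) :=
    (MeasurePreserving.id PU).prod
      (measurePreserving_pi _ _ fun _ => hshear.measurePreserving μ₁)
  have hdom := (L2Dominated.refl PU).prod ((l2Dominated_map_shear (unifCube dX a) hm).pi n)
  have hsq := hdom.measure_preimage_le hτ E₀
  have hM : 1 * (∫⁻ e, ENNReal.ofReal (Real.exp (m e ^ 2)) ∂unifCube dX a) ^ n ≤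
      ENNReal.ofReal 9 := by
    rw [one_mul]
    refine (pow_le_pow_left' hint n).trans ?_
    rw [← ENNReal.ofReal_pow (Real.exp_pos _).le, ← Real.exp_nat_mul]
    refine ENNReal.ofReal_le_ofReal ?_
    have hn' : (n : ℝ) ≠ 0 := by positivity
    rw [mul_div_cancel₀ _ hn', show (2 : ℝ) = 1 + 1 by norm_num, Real.exp_add]
    nlinarith [Real.exp_one_lt_three, Real.exp_pos 1]
  have hcover : (univ : Set (U × (Fin n → (Fin dX → ℝ) × ℝ))) ⊆ τ ⁻¹' E₀ ∪ E₁ := by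
    intro ω _
    have heq : D₀ (τ ω) = D₁ ω := path_unique (hD₀ (τ ω)) (hD₁ ω) fun i => by
      simp only [step, τ, shear, m, Prod.map, id]
      congr 2
      field_simp
      ring
    change f₁ x₀ / 2 ≤ |est (D₀ (τ ω)) ω.1 - 0| ∨ f₁ x₀ / 2 ≤ |est (D₁ ω) ω.1 - f₁ x₀|
    rw [heq]
    exact le_abs_sub_or_le_abs_sub (by linarith)
  have h1 : (1 : ℝ) ≤ (expLaw n dX PU a).real (τ ⁻¹' E₀) + 1 / 100 := by
    have h := (measure_mono hcover).trans (measure_union_le (μ := expLaw n dX PU a) _ _)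
    rw [measure_univ] at h
    have h' := h.trans (add_le_add_right hE₁.le _)
    rw [← ofReal_measureReal, ← ENNReal.ofReal_add measureReal_nonneg (by norm_num),
      ENNReal.one_le_ofReal] at h'
    exact h'
  have h2 : (expLaw n dX PU a).real (τ ⁻¹' E₀) ^ 2 ≤ 9 / 100 := by
    have h := hsq.trans (mul_le_mul' hM hE₀.le)
    rw [← ofReal_measureReal, ← ENNReal.ofReal_pow measureReal_nonneg,
      ← ENNReal.ofReal_mul (by norm_num), ENNReal.ofReal_le_ofReal_iff (by norm_num)] at h
    norm_num at h ⊢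
    exact h
  nlinarith

theorem card_le_two_mul_card_avoiding {ι Z : Type*} [Fintype ι] (z : Fin n → Z) (B : ι → Set Z)
    (hB : Pairwise fun k l => Disjoint (B k) (B l)) (hcard : 2 * n ≤ Fintype.card ι)
    [DecidablePred fun k => ∀ i, z i ∉ B k] :
    Fintype.card ι ≤ 2 * (Finset.univ.filter fun k => ∀ i, z i ∉ B k).card := by
  classical
  have hhit : (Finset.univ.filter fun k => ¬ ∀ i, z i ∉ B k).card ≤ n := by
    calc _ ≤ (Finset.univ.biUnion fun i : Fin n =>
          Finset.univ.filter fun k => z i ∈ B k).card :=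
        Finset.card_le_card fun k hk => by simpa using hk
      _ ≤ (Finset.univ : Finset (Fin n)).card * 1 := by
        refine Finset.card_biUnion_le_card_mul _ _ _ fun i _ => ?_
        refine Finset.card_le_one.2 fun k hk l hl => ?_
        simp only [Finset.mem_filter, Finset.mem_univ, true_and] at hk hl
        by_contra hkl
        exact Set.disjoint_left.1 (hB hkl) hk hl
      _ = n := by simp
  have := Finset.card_filter_add_card_filter_not (s := (Finset.univ : Finset ι))
    (fun k => ∀ i, z i ∉ B k)
  rw [Finset.card_univ] at this
  omega

/-- Among sufficiently many candidate locations of the dip, one is missed by the queries. -/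
theorem exists_hasRisk_dip [IsProbabilityMeasure PU] (ha : 0 < a) (hn : 0 < n) {ι : Type*}
    [Fintype ι] (z : ι → Cube dZ) {c ρ s : ℝ} (hs : 0 ≤ s) (hρ : 0 ≤ ρ)
    (hz : Pairwise fun k l => Disjoint (ball (z k) ρ) (ball (z l) ρ))
    (hcard : 2 * n ≤ Fintype.card ι) {f₁ : (Fin dX → ℝ) → ℝ}
    (hf₁ : ∀ e : Fin dX → ℝ, ‖e‖ ≤ a → f₁ ((x₀ + fun _ => c * ρ ^ s) + σX • e) = 0) :
    ∃ k, HasRisk ζ est PU x₀ σX σY (dip c ρ s (z k) x₀) (fun _ => 0) a (f₁ x₀ / 2) ∨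
      HasRisk ζ est PU x₀ σX σY (dip c ρ s (z k) x₀) f₁ a (f₁ x₀ / 2) := by
  classical
  by_contra! hcon
  choose D₀ hD₀ hE₀ using fun k => exists_path_of_not_hasRisk (hcon k).1
  choose D₁ hD₁ hE₁ using fun k => exists_path_of_not_hasRisk (hcon k).2
  have hι : 0 < Fintype.card ι := by omega
  have : Nonempty (Obs dX dZ) := ⟨z (Fintype.card_pos_iff.1 hι).some, 0, 0⟩
  choose D hD using fun ω : U × (Fin n → (Fin dX → ℝ) × ℝ) =>
    path_exists (step ζ σX σY (fun _ => x₀ + fun _ => c * ρ ^ s) (fun _ => 0) ω)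
  have := isProbabilityMeasure_expLaw n dX PU ha
  set μ := expLaw n dX PU a
  set G : ι → Set (U × (Fin n → (Fin dX → ℝ) × ℝ)) :=
    fun k => {ω | ∀ i, (D ω i).1 ∉ ball (z k) ρ}
  have hN : ∀ᵐ ω ∂μ, ∀ i, ‖(ω.2 i).1‖ ≤ a := ae_all_iff.2 fun i =>
    (measurePreserving_expLaw PU ha i).quasiMeasurePreserving.ae (ae_unifCube dX ha)
  have hG : ∀ k, μ (G k) ≤ ENNReal.ofReal (1 / 50) := fun k => by
    calc μ (G k) ≤ μ ({ω | f₁ x₀ / 2 ≤ |est (D₀ k ω) ω.1 - 0|} ∪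
          {ω | f₁ x₀ / 2 ≤ |est (D₁ k ω) ω.1 - f₁ x₀|}) := by
          refine measure_mono_ae ?_
          filter_upwards [hN] with ω hω hGω
          have hstep : ∀ i, dip c ρ s (z k) x₀ (D ω i).1 = x₀ + fun _ => c * ρ ^ s := fun i =>
            dip_of_le hs hρ x₀ (not_lt.1 (hGω i))
          have hquery : ∀ i, (D ω i).1 = ζ i (fun j => D ω ⟨j, j.2.trans i.2⟩) ω.1 := fun i => by
            rw [hD ω i]
            rfl
          have heq₀ : D ω = D₀ k ω := path_unique (hD ω) (hD₀ k ω) fun i => by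
            simp only [step, ← hquery, hstep]
          have heq₁ : D ω = D₁ k ω := path_unique (hD ω) (hD₁ k ω) fun i => by
            simp only [step, ← hquery, hstep, hf₁ _ (hω i)]
          change f₁ x₀ / 2 ≤ |est (D₀ k ω) ω.1 - 0| ∨ f₁ x₀ / 2 ≤ |est (D₁ k ω) ω.1 - f₁ x₀|
          rw [← heq₀, ← heq₁]
          exact le_abs_sub_or_le_abs_sub (by linarith)
      _ ≤ ENNReal.ofReal (1 / 100) + ENNReal.ofReal (1 / 100) :=
          (measure_union_le _ _).trans (add_le_add (hE₀ k).le (hE₁ k).le)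
      _ = ENNReal.ofReal (1 / 50) := by
          rw [← ENNReal.ofReal_add (by norm_num) (by norm_num)]
          norm_num
  have hsum : (Fintype.card ι : ℝ≥0∞) ≤ 2 * ∑ k, μ (G k) := by
    calc (Fintype.card ι : ℝ≥0∞) = ∫⁻ _, (Fintype.card ι : ℝ≥0∞) ∂μ := by simp
      _ ≤ ∫⁻ ω, 2 * ∑ k, (toMeasurable μ (G k)).indicator 1 ω ∂μ := by
          refine lintegral_mono fun ω => ?_
          have h := card_le_two_mul_card_avoiding (fun i => (D ω i).1)
            (fun k => ball (z k) ρ) hz hcard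
          calc (Fintype.card ι : ℝ≥0∞) ≤ 2 * ∑ k, (G k).indicator 1 ω := by
                simp only [Set.indicator_apply, Pi.one_apply, Finset.sum_boole, G, mem_ofPred_eq]
                exact_mod_cast h
            _ ≤ _ := by
                gcongr with k
                exact subset_toMeasurable μ (G k)
      _ = 2 * ∑ k, μ (G k) := by
          have hm : ∀ k, Measurable ((toMeasurable μ (G k)).indicator
              (1 : U × (Fin n → (Fin dX → ℝ) × ℝ) → ℝ≥0∞)) := fun k =>
            measurable_one.indicator (measurableSet_toMeasurable _ _)
          rw [lintegral_const_mul _ (Finset.measurable_fun_sum _ fun k _ => hm k),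
            lintegral_finsetSum _ fun k _ => hm k]
          simp [lintegral_indicator_one (measurableSet_toMeasurable _ _)]
  have hlast : (Fintype.card ι : ℝ≥0∞) ≤
      ENNReal.ofReal (2 * ((Fintype.card ι : ℝ) * (1 / 50))) := by
    refine hsum.trans ?_
    rw [ENNReal.ofReal_mul (by norm_num), ENNReal.ofReal_mul (by positivity)]
    simp only [ENNReal.ofReal_ofNat, ENNReal.ofReal_natCast]
    gcongr
    simpa using Finset.sum_le_sum fun k (_ : k ∈ Finset.univ) => hG k
  rw [← ENNReal.ofReal_natCast, ENNReal.ofReal_le_ofReal_iff (by positivity)] at hlast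
  have : (0 : ℝ) < Fintype.card ι := by exact_mod_cast hι
  linarith

end Experiment

section Grid

/-- The centers of the cells of the regular grid with `N` cells per side. -/
def gridCenter {N d : ℕ} (k : Fin d → Fin N) : Cube d := fun j =>
  ⟨((k j : ℝ) + 1 / 2) / N, by positivity, by
    have hN : (0 : ℝ) < N := by exact_mod_cast (k j).pos
    have h : ((k j : ℕ) : ℝ) + 1 ≤ N := by exact_mod_cast (k j).2
    rw [div_le_one hN]
    linarith⟩

theorem gridCenter_mem {N d : ℕ} (k : Fin d → Fin N) (j : Fin d) :
    1 / (2 * N : ℝ) ≤ (gridCenter k j : ℝ) ∧ (gridCenter k j : ℝ) ≤ 1 - 1 / (2 * N : ℝ) := by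
  have hN : (0 : ℝ) < N := by exact_mod_cast (k j).pos
  have h : ((k j : ℕ) : ℝ) + 1 ≤ N := by exact_mod_cast (k j).2
  have hk : (0 : ℝ) ≤ ((k j : ℕ) : ℝ) := by positivity
  simp only [gridCenter]
  constructor
  · rw [div_le_div_iff₀ (by positivity) hN]
    nlinarith
  · rw [div_le_iff₀ hN]
    field_simp
    linarith

theorem disjoint_ball_gridCenter {N d : ℕ} :
    Pairwise fun k l : Fin d → Fin N =>
      Disjoint (ball (gridCenter k) (1 / (2 * N : ℝ))) (ball (gridCenter l) (1 / (2 * N : ℝ))) := by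
  intro k l hkl
  obtain ⟨j, hj⟩ := Function.ne_iff.1 hkl
  have hN : (0 : ℝ) < N := by exact_mod_cast (k j).pos
  refine ball_disjoint_ball (le_trans ?_ (dist_le_pi_dist (gridCenter k) (gridCenter l) j))
  have hint : (1 : ℝ) ≤ |((k j : ℕ) : ℝ) - ((l j : ℕ) : ℝ)| := by
    have h : ((k j : ℕ) : ℤ) - ((l j : ℕ) : ℤ) ≠ 0 := by
      have : (k j : ℕ) ≠ (l j : ℕ) := fun h => hj (Fin.ext h)
      omega
    exact_mod_cast Int.one_le_abs h
  rw [Subtype.dist_eq, Real.dist_eq]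
  simp only [gridCenter]
  rw [← sub_div, abs_div, abs_of_pos hN, add_sub_add_right_eq_sub, le_div_iff₀ hN]
  field_simp
  linarith

end Grid

section Rates

variable {n dX dZ : ℕ} {U : Type} [MeasurableSpace U]

/-- Some admissible model with uniform noise for the covariates and Gaussian noise for the
responses has risk at least `δ`. -/
def ExistsHardModel (sg sf Lg Lf : ℝ) (ζ : (i : Fin n) → (Fin (i : ℕ) → Obs dX dZ) → U → Cube dZ)
    (est : (Fin n → Obs dX dZ) → U → ℝ) (PU : Measure U) (x₀ : Fin dX → ℝ) (σX σY δ : ℝ) : Prop :=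
  ∃ (g : Cube dZ → Fin dX → ℝ) (f : (Fin dX → ℝ) → ℝ) (a : ℝ), 0 < a ∧ a ≤ 1 ∧
    GlobHolderBall sg Lg g ∧ GlobHolderBall sf Lf f ∧
    (∃ z₀, g z₀ = x₀ ∧ HasLocalDim (volume : Measure (Fin dZ → unitInterval)) z₀ (dZ : ℝ)) ∧
    HasRisk ζ est PU x₀ σX σY g f a δ

variable {sg sf Lg Lf : ℝ} {ζ : (i : Fin n) → (Fin (i : ℕ) → Obs dX dZ) → U → Cube dZ}
  {est : (Fin n → Obs dX dZ) → U → ℝ} {PU : Measure U} {x₀ : Fin dX → ℝ} {σX σY : ℝ}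

theorem ExistsHardModel.mono {δ δ' : ℝ} (h : ExistsHardModel sg sf Lg Lf ζ est PU x₀ σX σY δ)
    (hδ : δ' ≤ δ) : ExistsHardModel sg sf Lg Lf ζ est PU x₀ σX σY δ' := by
  obtain ⟨g, f, a, h1, h2, h3, h4, h5, h6⟩ := h
  exact ⟨g, f, a, h1, h2, h3, h4, h5, h6.mono hδ⟩

theorem hasLocalDim_gridCenter {N d : ℕ} (hN : 0 < N) (k : Fin d → Fin N) :
    HasLocalDim (volume : Measure (Fin d → unitInterval)) (gridCenter k) (d : ℝ) :=
  hasLocalDim_volume_cube d _ (by positivity) (gridCenter_mem k)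

theorem existsHardModel_of_or {g : Cube dZ → Fin dX → ℝ} {f₁ : (Fin dX → ℝ) → ℝ} {a δ : ℝ}
    (ha : 0 < a) (ha1 : a ≤ 1) (hg : GlobHolderBall sg Lg g) (hLf : 0 ≤ Lf)
    (hf₁ : GlobHolderBall sf Lf f₁)
    (hz : ∃ z₀, g z₀ = x₀ ∧ HasLocalDim (volume : Measure (Fin dZ → unitInterval)) z₀ (dZ : ℝ))
    (h : HasRisk ζ est PU x₀ σX σY g (fun _ => 0) a δ ∨ HasRisk ζ est PU x₀ σX σY g f₁ a δ) :
    ExistsHardModel sg sf Lg Lf ζ est PU x₀ σX σY δ := by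
  rcases h with h | h
  · exact ⟨g, _, a, ha, ha1, hg, globHolderBall_const sf hLf 0, hz, h⟩
  · exact ⟨g, _, a, ha, ha1, hg, hf₁, hz, h⟩

theorem existsHardModel_of_const {f₁ : (Fin dX → ℝ) → ℝ} {δ : ℝ} (hLg : 0 ≤ Lg) (hLf : 0 ≤ Lf)
    (hf₁ : GlobHolderBall sf Lf f₁)
    (h : HasRisk ζ est PU x₀ σX σY (fun _ => x₀) (fun _ => 0) 1 δ ∨
      HasRisk ζ est PU x₀ σX σY (fun _ => x₀) f₁ 1 δ) :
    ExistsHardModel sg sf Lg Lf ζ est PU x₀ σX σY δ :=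
  existsHardModel_of_or one_pos le_rfl (globHolderBall_const sg hLg x₀) hLf hf₁
    ⟨gridCenter (N := 1) fun _ => 0, rfl, hasLocalDim_gridCenter one_pos _⟩ h

theorem one_div_le_one_div_rpow {b p : ℝ} (hb : 1 ≤ b) (hp : p ≤ 1) :
    1 / b ≤ (1 / b) ^ p := by
  have hb0 : 0 < b := by linarith
  simpa using Real.rpow_le_rpow_of_exponent_ge (by positivity : 0 < 1 / b)
    ((div_le_one hb0).2 hb) hp

theorem spike_add_smul_eq_zero {κ h : ℝ} (hsf : sf ∈ Ioc (0 : ℝ) 1) (hκ : 0 ≤ κ) (hh : 0 ≤ h)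
    (hσX : 0 < σX) {e : Fin dX → ℝ} (he : h / σX ≤ ‖e‖) :
    spike κ h sf x₀ (x₀ + σX • e) = 0 := by
  refine spike_eq_zero hsf.1.le hκ hh ?_
  rw [dist_eq_norm, add_sub_cancel_left, norm_smul, Real.norm_eq_abs, abs_of_pos hσX]
  rw [div_le_iff₀ hσX] at he
  linarith

theorem existsHardModel_covariateNoise [IsProbabilityMeasure PU] (hsf : sf ∈ Ioc (0 : ℝ) 1)
    (hLg : 0 < Lg) (hLf : 0 < Lf) (hdX : 0 < dX) (hn : 0 < n) (hσX : 0 < σX) :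
    ExistsHardModel sg sf Lg Lf ζ est PU x₀ σX σY
      (min Lf 1 / 4 * (σX ^ (dX : ℝ) / n) ^ (sf / (dX : ℝ))) := by
  have hκ : 0 < min Lf 1 := lt_min hLf one_pos
  have hn' : (0 : ℝ) < n := by exact_mod_cast hn
  set w := σX ^ (dX : ℝ) / n with hw
  have hw0 : 0 < w := by positivity
  set h := w ^ ((dX : ℝ)⁻¹) * (1 / 2) with hh
  have hh0 : 0 < h := by positivity
  have hpow : h ^ dX = w * (1 / 2) ^ dX := by
    rw [hh, mul_pow, Real.rpow_inv_natCast_pow hw0.le hdX.ne']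
  refine (existsHardModel_of_const hLg.le hLf.le
    (globHolderBall_spike (h := h) (x₀ := x₀) hsf hκ.le (min_le_left _ _))
    (hasRisk_or_of_rarely_distinct one_pos (r := h / σX) ?_ fun e he =>
      spike_add_smul_eq_zero hsf hκ.le hh0.le hσX he.le)).mono ?_
  · refine (mul_le_mul_right (unifCube_closedBall_le dX one_pos (by positivity)) _).trans ?_
    rw [← ENNReal.ofReal_natCast n, ← ENNReal.ofReal_pow (by positivity),
      ← ENNReal.ofReal_mul (by positivity)]
    refine ENNReal.ofReal_le_ofReal ?_
    rw [inv_one, one_mul, div_pow, hpow, hw, Real.rpow_natCast]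
    field_simp
    have := pow_le_pow_right₀ (one_le_two : (1 : ℝ) ≤ 2) hdX
    rw [pow_one] at this
    simpa [← div_eq_mul_inv, div_le_one] using this
  · rw [spike_self hsf.1 hκ.le hh0.le, hh, Real.mul_rpow (by positivity) (by norm_num),
      ← Real.rpow_mul hw0.le, inv_mul_eq_div]
    have := one_div_le_one_div_rpow (one_le_two : (1 : ℝ) ≤ 2) hsf.2
    have h2 := mul_le_mul_of_nonneg_left this
      (by positivity : 0 ≤ min Lf 1 * w ^ (sf / (dX : ℝ)))
    linarith

theorem existsHardModel_parametric [IsProbabilityMeasure PU]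
    (hLg : 0 < Lg) (hLf : 0 < Lf) (hn : 0 < n) (hσY : 0 < σY) :
    ExistsHardModel sg sf Lg Lf ζ est PU x₀ σX σY (σY / Real.sqrt n / 2) := by
  have hn' : (0 : ℝ) < n := by exact_mod_cast hn
  have := isProbabilityMeasure_unifCube dX one_pos
  refine existsHardModel_of_const hLg.le hLf.le
    (globHolderBall_const sf hLf.le (σY / Real.sqrt n))
    (hasRisk_or_of_lintegral_le one_pos hn hσY measurable_const ?_)
  rw [lintegral_const, measure_univ, mul_one]
  refine ENNReal.ofReal_le_ofReal (Real.exp_le_exp.2 ?_)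
  rw [div_div_cancel_left' hσY.ne', inv_pow, Real.sq_sqrt hn'.le, inv_eq_one_div]
  gcongr
  norm_num

theorem existsHardModel_responseNoise [IsProbabilityMeasure PU] (hsf : sf ∈ Ioc (0 : ℝ) 1)
    (hLg : 0 < Lg) (hLf : 0 < Lf) (hdX : 0 < dX) (hn : 0 < n) (hσX : 0 < σX) (hσY : 0 < σY)
    (hle : (σX ^ (dX : ℝ) / n) ^ (sf / (dX : ℝ)) ≤
      (σX ^ (dX : ℝ) * σY ^ 2 / n) ^ (sf / (2 * sf + (dX : ℝ)))) :
    ExistsHardModel sg sf Lg Lf ζ est PU x₀ σX σY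
      (min Lf 1 / 2 * (σX ^ (dX : ℝ) * σY ^ 2 / n) ^ (sf / (2 * sf + (dX : ℝ)))) := by
  have hκ : 0 < min Lf 1 := lt_min hLf one_pos
  have hsf0 : 0 < sf := hsf.1
  have hn' : (0 : ℝ) < n := by exact_mod_cast hn
  have := isProbabilityMeasure_unifCube dX one_pos
  set v := σX ^ (dX : ℝ) / n with hv
  have hv0 : 0 < v := by positivity
  set w := σX ^ (dX : ℝ) * σY ^ 2 / n with hw
  have hw0 : 0 < w := by positivity
  have hwv : w = v * σY ^ 2 := by rw [hw, hv]; ring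
  set h := w ^ ((2 * sf + (dX : ℝ))⁻¹) with hh
  have hh0 : 0 < h := by positivity
  have hhs : w ^ (sf / (2 * sf + (dX : ℝ))) = h ^ sf := by
    rw [hh, ← Real.rpow_mul hw0.le, inv_mul_eq_div]
  have hprod : (h ^ sf) ^ 2 * h ^ dX = w := by
    rw [← Real.rpow_natCast (h ^ sf), ← Real.rpow_mul hh0.le, ← Real.rpow_natCast h,
      ← Real.rpow_add hh0, hh, ← Real.rpow_mul hw0.le]
    push_cast
    rw [mul_comm sf 2, inv_mul_cancel₀ (by positivity), Real.rpow_one]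
  have hvh : v ≤ h ^ dX := by
    rw [hhs, ← inv_mul_eq_div, Real.rpow_mul hv0.le,
      Real.rpow_le_rpow_iff (by positivity) hh0.le hsf0] at hle
    simpa [Real.rpow_inv_natCast_pow hv0.le hdX.ne'] using
      pow_le_pow_left₀ (by positivity) hle dX
  set q := (h ^ sf / σY) ^ 2 with hq
  have hq1 : q ≤ 1 := by
    rw [hq, div_pow, div_le_one (by positivity)]
    have h1 : (h ^ sf) ^ 2 * h ^ dX ≤ σY ^ 2 * h ^ dX := by
      rw [hprod, hwv, mul_comm]
      gcongr
    exact le_of_mul_le_mul_right h1 (by positivity)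
  have hqr : q * (h / σX) ^ dX = 1 / n := by
    rw [hq, div_pow, div_pow, div_mul_div_comm, hprod, hw, Real.rpow_natCast]
    field_simp
  rw [hhs]
  refine (existsHardModel_of_const hLg.le hLf.le
    (globHolderBall_spike (h := h) (x₀ := x₀) hsf hκ.le (min_le_left _ _))
    (hasRisk_or_of_lintegral_le one_pos hn hσY ?_ ?_)).mono ?_
  · unfold spike
    fun_prop
  · have hpt : ∀ e : Fin dX → ℝ,
        ENNReal.ofReal (Real.exp ((spike (min Lf 1) h sf x₀ (x₀ + σX • e) / σY) ^ 2)) ≤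
          1 + (closedBall (0 : Fin dX → ℝ) (h / σX)).indicator
            (fun _ => ENNReal.ofReal (2 * q)) e := by
      intro e
      by_cases he : e ∈ closedBall (0 : Fin dX → ℝ) (h / σX)
      · rw [indicator_of_mem he, ← ENNReal.ofReal_one,
          ← ENNReal.ofReal_add zero_le_one (by positivity)]
        refine ENNReal.ofReal_le_ofReal ?_
        have hm : (spike (min Lf 1) h sf x₀ (x₀ + σX • e) / σY) ^ 2 ≤ q := by
          rw [hq]
          have h0 := spike_nonneg (κ := min Lf 1) (h := h) (s := sf) x₀ (x₀ + σX • e)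
          gcongr
          refine (spike_le hκ.le hh0.le _ _).trans ?_
          exact mul_le_of_le_one_left (by positivity) (min_le_right _ _)
        have hq0 : 0 ≤ q := by positivity
        have habs := Real.abs_exp_sub_one_le (x := q) (by rwa [abs_of_nonneg hq0])
        rw [abs_of_nonneg hq0] at habs
        have := Real.exp_le_exp.2 hm
        linarith [le_abs_self (Real.exp q - 1)]
      · rw [indicator_of_notMem he, spike_add_smul_eq_zero hsf hκ.le hh0.le hσX]
        · simp
        · rw [mem_closedBall_zero_iff, not_le] at he
          exact he.le
    refine (lintegral_mono hpt).trans ?_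
    rw [lintegral_add_left measurable_const, lintegral_indicator_const measurableSet_closedBall,
      lintegral_const, measure_univ, mul_one]
    calc 1 + ENNReal.ofReal (2 * q) * unifCube dX 1 (closedBall 0 (h / σX))
        ≤ 1 + ENNReal.ofReal (2 * q) * ENNReal.ofReal (1⁻¹ * (h / σX)) ^ dX := by
          gcongr
          exact unifCube_closedBall_le dX one_pos (by positivity)
      _ = ENNReal.ofReal (1 + 2 / n) := by
          rw [inv_one, one_mul, ← ENNReal.ofReal_pow (by positivity),
            ← ENNReal.ofReal_mul (by positivity), mul_assoc, hqr,
            ENNReal.ofReal_add zero_le_one (by positivity), ENNReal.ofReal_one]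
          congr 2
          ring
      _ ≤ _ := ENNReal.ofReal_le_ofReal (by
          have := Real.add_one_le_exp (2 / n : ℝ)
          linarith)
  · rw [spike_self hsf.1 hκ.le hh0.le]
    apply le_of_eq
    ring

theorem exists_grid_size {d : ℕ} (hd : 0 < d) (hn : 0 < n) :
    ∃ N : ℕ, 0 < N ∧ 2 * n ≤ N ^ d ∧ 1 / 8 * (1 / (n : ℝ)) ^ ((d : ℝ)⁻¹) ≤ 1 / (2 * N : ℝ) := by
  have hn1 : (1 : ℝ) ≤ n := by exact_mod_cast hn
  have hn' : (0 : ℝ) < n := by linarith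
  set x := (2 * n : ℝ) ^ ((d : ℝ)⁻¹) with hx
  have hx1 : 1 ≤ x := Real.one_le_rpow (by linarith) (by positivity)
  have hxd : x ^ d = 2 * n := Real.rpow_inv_natCast_pow (by positivity) hd.ne'
  have hd1 : (d : ℝ)⁻¹ ≤ 1 := inv_le_one_of_one_le₀ (by exact_mod_cast hd)
  have hx2 : x ≤ 2 * (n : ℝ) ^ ((d : ℝ)⁻¹) := by
    rw [hx, Real.mul_rpow (by norm_num) hn'.le]
    gcongr
    simpa using Real.rpow_le_rpow_of_exponent_le (one_le_two : (1 : ℝ) ≤ 2) hd1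
  have hN0 : 0 < ⌈x⌉₊ := Nat.ceil_pos.2 (by linarith)
  refine ⟨⌈x⌉₊, hN0, ?_, ?_⟩
  · have : (2 * n : ℝ) ≤ (⌈x⌉₊ : ℝ) ^ d := by
      rw [← hxd]
      gcongr
      exact Nat.le_ceil x
    exact_mod_cast this
  · have hceil : (⌈x⌉₊ : ℝ) ≤ 4 * (n : ℝ) ^ ((d : ℝ)⁻¹) := by
      have := Nat.ceil_lt_add_one (by linarith : 0 ≤ x)
      linarith
    have hN0' : (0 : ℝ) < ⌈x⌉₊ := by exact_mod_cast hN0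
    have hy : 0 < (n : ℝ) ^ ((d : ℝ)⁻¹) := by positivity
    rw [one_div (n : ℝ), Real.inv_rpow hn'.le, ← one_div, div_mul_div_comm, one_mul,
      div_le_div_iff₀ (by positivity) (by positivity)]
    linarith

theorem existsHardModel_noiseless [IsProbabilityMeasure PU] (hsg : sg ∈ Ioc (0 : ℝ) 1)
    (hsf : sf ∈ Ioc (0 : ℝ) 1) (hLg : 0 < Lg) (hLf : 0 < Lf) (hdX : 0 < dX) (hdZ : 0 < dZ)
    (hn : 0 < n) (hσX : 0 ≤ σX) :
    ExistsHardModel sg sf Lg Lf ζ est PU x₀ σX σY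
      (min Lf 1 * (Lg / 2) ^ sf / 16 * (1 / (n : ℝ)) ^ (sf * sg / (dZ : ℝ))) := by
  have hκ : 0 < min Lf 1 := lt_min hLf one_pos
  have hsf0 : 0 < sf := hsf.1
  have hsg0 : 0 < sg := hsg.1
  obtain ⟨N, hN, hcard, hNρ⟩ := exists_grid_size (d := dZ) hdZ hn
  have hN' : (0 : ℝ) < N := by exact_mod_cast hN
  have hn' : (0 : ℝ) < n := by exact_mod_cast hn
  have : Nonempty (Fin dX) := ⟨⟨0, hdX⟩⟩
  set ρ := 1 / (2 * N : ℝ)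
  have hρ : 0 < ρ := by positivity
  set h := Lg / 2 * ρ ^ sg with hh
  have hh0 : 0 < h := by positivity
  set a := min 1 (h / (σX + 1))
  have ha : 0 < a := lt_min one_pos (by positivity)
  have haσ : σX * a ≤ h := by
    calc σX * a ≤ (σX + 1) * (h / (σX + 1)) := by
          gcongr
          · linarith
          · exact min_le_right _ _
      _ = h := by field_simp
  obtain ⟨k, hk⟩ := exists_hasRisk_dip (ζ := ζ) (est := est) (PU := PU) (x₀ := x₀) (σX := σX)
    (σY := σY) (c := Lg) (s := sg) (f₁ := spike (min Lf 1) h sf x₀) ha hn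
    (gridCenter (N := N) (d := dZ)) hsg0.le hρ.le disjoint_ball_gridCenter (by simpa using hcard)
    fun e he => by
      refine spike_eq_zero hsf0.le hκ.le hh0.le ?_
      rw [dist_eq_norm, add_assoc, add_sub_cancel_left]
      have h1 := norm_sub_le_norm_add (fun _ : Fin dX => Lg * ρ ^ sg) (σX • e)
      rw [pi_norm_const, Real.norm_of_nonneg (by positivity), norm_smul,
        Real.norm_of_nonneg hσX] at h1
      have h2 := mul_le_mul_of_nonneg_left he hσX
      linarith
  refine (existsHardModel_of_or ha (min_le_left _ _) (globHolderBall_dip hsg hLg.le _ x₀) hLf.le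
    (globHolderBall_spike hsf hκ.le (min_le_left _ _) x₀)
    ⟨gridCenter k, dip_self hsg0 hρ.le _ _, hasLocalDim_gridCenter hN k⟩ hk).mono ?_
  rw [spike_self hsf0 hκ.le hh0.le, hh, Real.mul_rpow (by positivity) (by positivity),
    ← Real.rpow_mul hρ.le]
  have hrate : 1 / 8 * (1 / (n : ℝ)) ^ (sf * sg / (dZ : ℝ)) ≤ ρ ^ (sg * sf) := by
    calc _ ≤ (1 / 8 : ℝ) ^ (sg * sf) * ((1 / (n : ℝ)) ^ ((dZ : ℝ)⁻¹)) ^ (sg * sf) := by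
          rw [← Real.rpow_mul (by positivity), inv_mul_eq_div, mul_comm sf sg]
          gcongr
          exact one_div_le_one_div_rpow (by norm_num) (mul_le_one₀ hsg.2 hsf0.le hsf.2)
      _ = (1 / 8 * (1 / (n : ℝ)) ^ ((dZ : ℝ)⁻¹)) ^ (sg * sf) :=
          (Real.mul_rpow (by norm_num) (by positivity)).symm
      _ ≤ _ := by gcongr
  have := mul_le_mul_of_nonneg_left hrate
    (by positivity : 0 ≤ min Lf 1 * (Lg / 2) ^ sf / 2)
  linarith

theorem existsHardModel_max [IsProbabilityMeasure PU] (hsg : sg ∈ Ioc (0 : ℝ) 1)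
    (hsf : sf ∈ Ioc (0 : ℝ) 1) (hLg : 0 < Lg) (hLf : 0 < Lf) (hdX : 0 < dX) (hdZ : 0 < dZ)
    (hn : 0 < n) (hσX : 0 ≤ σX) (hσY : 0 ≤ σY) :
    ExistsHardModel sg sf Lg Lf ζ est PU x₀ σX σY
      (min (min Lf 1 / 4) (min Lf 1 * (Lg / 2) ^ sf / 16) *
        max (max ((1 / (n : ℝ)) ^ (sf * sg / (dZ : ℝ))) ((σX ^ (dX : ℝ) / n) ^ (sf / (dX : ℝ))))
          (max (σY / Real.sqrt n)
            ((σX ^ (dX : ℝ) * σY ^ 2 / n) ^ (sf / (2 * sf + (dX : ℝ)))))) := by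
  have hκ : 0 < min Lf 1 := lt_min hLf one_pos
  have hκ1 : min Lf 1 ≤ 1 := min_le_right _ _
  have hsf0 : 0 < sf := hsf.1
  have hn' : (0 : ℝ) < n := by exact_mod_cast hn
  have hdX' : (0 : ℝ) < dX := by exact_mod_cast hdX
  set A := (1 / (n : ℝ)) ^ (sf * sg / (dZ : ℝ)) with hA
  set B := (σX ^ (dX : ℝ) / n) ^ (sf / (dX : ℝ)) with hB
  set C := σY / Real.sqrt n with hC
  set E := (σX ^ (dX : ℝ) * σY ^ 2 / n) ^ (sf / (2 * sf + (dX : ℝ))) with hE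
  have hA0 : 0 < A := by positivity
  have hB0 : 0 ≤ B := by positivity
  have hC0 : 0 ≤ C := by positivity
  have hE0 : 0 ≤ E := by positivity
  have hBpos : 0 < B → 0 < σX := fun h => hσX.lt_of_ne' fun h0 => by
    rw [hB, h0, Real.zero_rpow hdX'.ne', zero_div, Real.zero_rpow (by positivity)] at h
    exact h.false
  have hEpos : 0 < E → 0 < σX ∧ 0 < σY := fun h => by
    constructor
    · refine hσX.lt_of_ne' fun h0 => ?_
      rw [hE, h0, Real.zero_rpow hdX'.ne', zero_mul, zero_div, Real.zero_rpow (by positivity)] at h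
      exact h.false
    · refine hσY.lt_of_ne' fun h0 => ?_
      rw [hE, h0, zero_pow two_ne_zero, mul_zero, zero_div, Real.zero_rpow (by positivity)] at h
      exact h.false
  set c := min (min Lf 1 / 4) (min Lf 1 * (Lg / 2) ^ sf / 16)
  have hc : c ≤ min Lf 1 / 4 := min_le_left _ _
  rcases le_total (max C E) (max A B) with hmax | hmax
  · rw [max_eq_left hmax]
    rcases le_total B A with hBA | hAB
    · rw [max_eq_left hBA]
      exact (existsHardModel_noiseless hsg hsf hLg hLf hdX hdZ hn hσX).mono
        (mul_le_mul_of_nonneg_right (min_le_right _ _) hA0.le)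
    · rw [max_eq_right hAB]
      exact (existsHardModel_covariateNoise hsf hLg hLf hdX hn (hBpos (hA0.trans_le hAB))).mono
        (mul_le_mul_of_nonneg_right hc hB0)
  · rw [max_eq_right hmax]
    have hAmax : 0 < max C E := hA0.trans_le ((le_max_left _ _).trans hmax)
    have hBmax : B ≤ max C E := (le_max_right _ _).trans hmax
    rcases le_total E C with hEC | hCE
    · rw [max_eq_left hEC] at hAmax ⊢
      have hσY' : 0 < σY := hσY.lt_of_ne' fun h0 => by
        rw [hC, h0, zero_div] at hAmax
        exact hAmax.false
      refine (existsHardModel_parametric hLg hLf hn hσY').mono ?_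
      have := mul_le_mul_of_nonneg_right (hc.trans (by linarith : _ ≤ (1 / 2 : ℝ))) hC0
      linarith
    · rw [max_eq_right hCE] at hAmax hBmax ⊢
      obtain ⟨hσX', hσY'⟩ := hEpos hAmax
      exact (existsHardModel_responseNoise hsf hLg hLf hdX hn hσX' hσY' hBmax).mono
        (mul_le_mul_of_nonneg_right (hc.trans (by linarith)) hE0)

end Rates

end ActiveLowerBound

/-- **Theorem 4 (Active Lower Bound).**
With `𝒵 = [0,1]^{d_Z}` and `𝒳 = ℝ^{d_X}`, there are constants `c₁, c₂ > 0`, depending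
only on `L_g, s_g, L_f, s_f, d_X, d_Z`, such that every active estimator (each query `Z_i`
a measurable, possibly randomized, function of the previous observations, and the final
estimate a measurable function of the full dataset) incurs error at least `c₁ Φ_{A,*}`
with probability at least `c₂` for some model satisfying the assumptions. -/
theorem active_lower_bound
    (sg sf Lg Lf : ℝ) (dX dZ : ℕ)
    (hsg : sg ∈ Set.Ioc (0:ℝ) 1) (hsf : sf ∈ Set.Ioc (0:ℝ) 1)
    (hLg : 0 < Lg) (hLf : 0 < Lf) (hdX : 0 < dX) (hdZ : 0 < dZ) :
    ∃ c₁ c₂ : ℝ, 0 < c₁ ∧ 0 < c₂ ∧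
      ∀ (n : ℕ), 0 < n →
      ∀ (σX σY : ℝ), 0 ≤ σX → 0 ≤ σY →
      ∀ x0 : Fin dX → ℝ,
      -- the active procedure: query functions `ζ` and estimator `est`, both possibly
      -- randomized through an auxiliary variable `u ~ P_U`
      ∀ (U : Type) [MeasurableSpace U] (PU : Measure U) [IsProbabilityMeasure PU]
        (ζ : (i : Fin n) → (Fin (i : ℕ) → Cube dZ × (Fin dX → ℝ) × ℝ) → U → Cube dZ)
        (est : (Fin n → Cube dZ × (Fin dX → ℝ) × ℝ) → U → ℝ),
        (∀ i : Fin n, Measurable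
          (fun p : (Fin (i : ℕ) → Cube dZ × (Fin dX → ℝ) × ℝ) × U => ζ i p.1 p.2)) →
        Measurable (fun p : (Fin n → Cube dZ × (Fin dX → ℝ) × ℝ) × U => est p.1 p.2) →
      ∃ (g : Cube dZ → Fin dX → ℝ) (f : (Fin dX → ℝ) → ℝ)
        (PZ : Measure (Cube dZ)) (PeX : Measure (Fin dX → ℝ)) (PeY : Measure ℝ),
        IsProbabilityMeasure PZ ∧ IsProbabilityMeasure PeX ∧ IsProbabilityMeasure PeY ∧
        GlobHolderBall sg Lg g ∧ GlobHolderBall sf Lf f ∧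
        (∃ z0 : Cube dZ, g z0 = x0 ∧ HasLocalDim PZ z0 (dZ : ℝ)) ∧
        HasLocalDim PeX 0 (dX : ℝ) ∧
        SubGaussianVec PeX ∧ SubGaussianReal PeY ∧
        (∀ j, ∫ x, x j ∂PeX = 0) ∧ (∫ y, y ∂PeY = 0) ∧
        -- the sequential trajectory generated by the procedure interacting with the model
        ∀ (Z : Fin n → U × (Fin n → (Fin dX → ℝ) × ℝ) → Cube dZ)
          (X : Fin n → U × (Fin n → (Fin dX → ℝ) × ℝ) → (Fin dX → ℝ))
          (Y : Fin n → U × (Fin n → (Fin dX → ℝ) × ℝ) → ℝ),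
          (∀ i ω, Z i ω = ζ i (fun j =>
              (Z ⟨(j : ℕ), j.2.trans i.2⟩ ω,
               X ⟨(j : ℕ), j.2.trans i.2⟩ ω,
               Y ⟨(j : ℕ), j.2.trans i.2⟩ ω)) ω.1) →
          (∀ i ω, X i ω = g (Z i ω) + σX • (ω.2 i).1) →
          (∀ i ω, Y i ω = f (X i ω) + σY * (ω.2 i).2) →
          c₂ ≤
            ((PU.prod (Measure.pi fun _ : Fin n => PeX.prod PeY))
              {ω | c₁ * (max
                  (max ((1 / (n : ℝ)) ^ (sf * sg / (dZ : ℝ)))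
                       ((σX ^ (dX : ℝ) / n) ^ (sf / (dX : ℝ))))
                  (max (σY / Real.sqrt n)
                       ((σX ^ (dX : ℝ) * σY ^ 2 / n) ^ (sf / (2 * sf + (dX : ℝ)))))) ≤
                |est (fun i => (Z i ω, X i ω, Y i ω)) ω.1 - f x0|}).toReal := by
  have hκ : 0 < min Lf 1 := lt_min hLf one_pos
  refine ⟨min (min Lf 1 / 4) (min Lf 1 * (Lg / 2) ^ sf / 16), 1 / 100,
    lt_min (by positivity) (by positivity), by norm_num, ?_⟩
  intro n hn σX σY hσX hσY x0 U _ PU _ ζ est _ _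
  obtain ⟨g, f, a, ha, ha1, hg, hf, hz, hrisk⟩ :=
    ActiveLowerBound.existsHardModel_max (ζ := ζ) (est := est) (PU := PU) (x₀ := x0)
      hsg hsf hLg hLf hdX hdZ hn hσX hσY
  have hpX := ActiveLowerBound.isProbabilityMeasure_unifCube dX ha
  refine ⟨g, f, (volume : Measure (Fin dZ → unitInterval)), ActiveLowerBound.unifCube dX a,
    ProbabilityTheory.gaussianReal 0 1, inferInstance, hpX, inferInstance, hg, hf, hz,
    ActiveLowerBound.hasLocalDim_unifCube dX ha, ActiveLowerBound.subGaussianVec_unifCube dX ha ha1,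
    ActiveLowerBound.subGaussianReal_gaussianReal, ActiveLowerBound.integral_unifCube dX ha,
    ProbabilityTheory.integral_id_gaussianReal, ?_⟩
  intro Z X Y hZ hX hY
  have h := hrisk (fun ω i => (Z i ω, X i ω, Y i ω)) fun ω i => by
    simp only [ActiveLowerBound.step, ← hZ, ← hX, ← hY]
  have := ActiveLowerBound.isProbabilityMeasure_expLaw n dX PU ha
  exact (ENNReal.ofReal_le_iff_le_toReal (measure_ne_top _ _)).1 h

end
end

section
/- (Minimax lower bound without noise, active and passive cases; Proposition 2.) With 𝒵 = [0,1]^{d_Z} and 𝒳 = ℝ^{d_X}, for both active and passive estimators f̂_{x_0} (in the active case, each Z_i may be an arbitrary measurable, possibly randomized, function of the previous observations), there exists a constant C > 0 depending only on L_g, s_g, L_f, s_f, d_X, d_Z such that the supremum over all g, f, P_Z, ε_X, ε_Y satisfying the assumptions of P[ |f̂_{x_0} − f(x_0)| ≥ C n^{−s_f s_g/d_Z} ] is at least 2^{−(d_Z + 2)}. Explicitly, one may take C = L_f L_g^{s_f} / ( 2 ‖K_{d_X}‖_{C^{s_f}} ‖K_{d_Z}‖_{C^{s_g}}^{s_f}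 ( (2n)^{s_f s_g/d_Z} + 1 ) · n^{−s_f s_g/d_Z} )^{−1}, i.e., the threshold is L_f L_g^{s_f} / ( 2 ‖K_{d_X}‖_{C^{s_f}} ‖K_{d_Z}‖_{C^{s_g}}^{s_f} ( (2n)^{s_f s_g/d_Z} + 1 ) ), where K_d is the standard d-dimensional bump function. The supremum is over g in the global Hölder ball C^{s_g}(𝒵; 𝒳; L_g) with g(z_0) = x_0 for some z_0 around which P_Z has local dimension d_Z, f in the global Hölder ball C^{s_f}(𝒳; ℝ; L_f), distributions P_Z, sub-Gaussian ε_X with local dimension d_X around 0, and sub-Gaussian ε_Y. -/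
open MeasureTheory Filter Metric

noncomputable section

/-! ### Hölder functions -/

lemma abs_rpow_sub_rpow_le {s a b : ℝ} (hs : s ∈ Set.Ioc (0 : ℝ) 1) (ha : 0 ≤ a) (hb : 0 ≤ b) :
    |a ^ s - b ^ s| ≤ |a - b| ^ s := by
  wlog hab : b ≤ a generalizing a b
  · rw [abs_sub_comm, abs_sub_comm a b]
    exact this hb ha (le_of_not_ge hab)
  have h := Real.rpow_add_le_add_rpow hb (sub_nonneg.2 hab) hs.1.le hs.2
  rw [add_sub_cancel] at h
  rw [abs_of_nonneg (sub_nonneg.2 (Real.rpow_le_rpow hb hab hs.1.le)),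
    abs_of_nonneg (sub_nonneg.2 hab)]
  linarith

/-- The function `x ↦ L * dist x p ^ s`, truncated at the level `L * r ^ s` which it reaches
on the sphere of radius `r` around `p`. -/
def truncDistPow {X : Type*} [PseudoMetricSpace X] (L s r : ℝ) (p x : X) : ℝ :=
  min (L * r ^ s) (L * dist x p ^ s)

lemma abs_truncDistPow_sub_le {X : Type*} [PseudoMetricSpace X] {L s : ℝ} (hL : 0 ≤ L)
    (hs : s ∈ Set.Ioc (0 : ℝ) 1) (r : ℝ) (p x y : X) :
    |truncDistPow L s r p x - truncDistPow L s r p y| ≤ L * dist x y ^ s := by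
  refine (abs_min_sub_min_le_max _ _ _ _).trans ?_
  rw [sub_self, abs_zero, max_eq_right (abs_nonneg _), ← mul_sub, abs_mul, abs_of_nonneg hL]
  gcongr
  exact (abs_rpow_sub_rpow_le hs dist_nonneg dist_nonneg).trans
    (Real.rpow_le_rpow (abs_nonneg _) (abs_dist_sub_le _ _ _) hs.1.le)

lemma truncDistPow_self {X : Type*} [PseudoMetricSpace X] {L s r : ℝ} (hL : 0 ≤ L) (hs : 0 < s)
    (hr : 0 ≤ r) (p : X) : truncDistPow L s r p p = 0 := by
  rw [truncDistPow, dist_self, Real.zero_rpow hs.ne', mul_zero]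
  exact min_eq_right (by positivity)

lemma truncDistPow_of_le_dist {X : Type*} [PseudoMetricSpace X] {L s r : ℝ} (hL : 0 ≤ L)
    (hs : 0 < s) (hr : 0 ≤ r) {p x : X} (h : r ≤ dist x p) :
    truncDistPow L s r p x = L * r ^ s :=
  min_eq_left (mul_le_mul_of_nonneg_left (Real.rpow_le_rpow hr h hs.le) hL)

/-- The design function: it takes the value `x0` at `z0` and is constant outside the ball of
radius `r` around `z0`. -/
def dip {Z : Type*} [PseudoMetricSpace Z] {d : ℕ} (L s r : ℝ) (x0 : Fin d → ℝ) (z0 z : Z) :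
    Fin d → ℝ :=
  fun j => x0 j + truncDistPow L s r z0 z

lemma globHolderBall_dip {Z : Type*} [PseudoMetricSpace Z] {d : ℕ} {L s : ℝ} (hL : 0 ≤ L)
    (hs : s ∈ Set.Ioc (0 : ℝ) 1) (r : ℝ) (x0 : Fin d → ℝ) (z0 : Z) :
    GlobHolderBall s L (dip L s r x0 z0) := by
  intro z y
  refine (dist_pi_le_iff (by positivity)).2 fun j => ?_
  rw [Real.dist_eq, dip, dip, add_sub_add_left_eq_sub]
  exact abs_truncDistPow_sub_le hL hs r z0 z y

/-- The peak of height `ε * L * r ^ s` at `x0`, supported in the ball of radius `r` around `x0`. -/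
def peak {X : Type*} [PseudoMetricSpace X] (L s r ε : ℝ) (x0 x : X) : ℝ :=
  ε * (L * r ^ s - truncDistPow L s r x0 x)

lemma globHolderBall_peak {X : Type*} [PseudoMetricSpace X] {L s ε : ℝ} (hL : 0 ≤ L)
    (hs : s ∈ Set.Ioc (0 : ℝ) 1) (hε : |ε| = 1) (r : ℝ) (x0 : X) :
    GlobHolderBall s L (peak L s r ε x0) := by
  intro x y
  rw [Real.dist_eq, peak, peak, ← mul_sub, abs_mul, hε, one_mul, sub_sub_sub_cancel_left,
    abs_sub_comm]
  exact abs_truncDistPow_sub_le hL hs r x0 x y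

lemma holderSeminorm_bumpFn {d : ℕ} (hd : 0 < d) (s : ℝ) :
    holderSeminorm s (bumpFn d) = 0 ∨ 1 ≤ holderSeminorm s (bumpFn d) := by
  have : Nonempty (Fin d) := ⟨⟨0, hd⟩⟩
  by_cases hb : BddAbove (Set.range fun p : (Fin d → ℝ) × (Fin d → ℝ) =>
      if dist p.1 p.2 = 0 then 0 else dist (bumpFn d p.1) (bumpFn d p.2) / dist p.1 p.2 ^ s)
  · right
    refine le_trans (le_of_eq ?_) (le_ciSup hb ((fun _ => 0), (fun _ => 1)))
    have h1 : bumpFn d (fun _ => 0) = 1 := by simp [bumpFn]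
    have h2 : bumpFn d (fun _ => 1) = 0 := by
      have : ¬ ((d : ℝ) < 1) := not_lt.2 (by exact_mod_cast hd)
      simp [bumpFn, this]
    have h3 : dist (fun _ : Fin d => (0 : ℝ)) (fun _ => 1) = 1 := by
      rw [dist_pi_const]; simp
    simp only [h1, h2, h3]
    simp
  · exact Or.inl (Real.iSup_of_not_bddAbove hb)

lemma threshold_le {sg sf Lg Lf b : ℝ} {dX dZ : ℕ} (hsf : 0 < sf) (hLg : 0 < Lg) (hLf : 0 < Lf)
    (hdX : 0 < dX) (hdZ : 0 < dZ) (hb : 0 < b) :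
    Lf * Lg ^ sf / (2 * holderSeminorm sf (bumpFn dX) * holderSeminorm sg (bumpFn dZ) ^ sf * b) ≤
      Lf * (Lg ^ sf / (2 * b)) := by
  have hpos : 0 ≤ Lf * (Lg ^ sf / (2 * b)) := by positivity
  rcases holderSeminorm_bumpFn hdX sf with h | hX
  · simpa [h] using hpos
  rcases holderSeminorm_bumpFn hdZ sg with h | hZ
  · simpa [h, Real.zero_rpow hsf.ne'] using hpos
  have hZ' := Real.one_le_rpow hZ hsf.le
  rw [← mul_div_assoc]
  refine div_le_div_of_nonneg_left (by positivity) (by positivity) ?_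
  have := one_le_mul_of_one_le_of_one_le hX hZ'
  nlinarith

/-! ### The uniform distribution on a small cube -/

/-- The uniform distribution on `[-δ, δ]`. -/
def unifIcc (δ : ℝ) : Measure ℝ := ProbabilityTheory.cond volume (Set.Icc (-δ) δ)

lemma isProbabilityMeasure_unifIcc {δ : ℝ} (hδ : 0 < δ) : IsProbabilityMeasure (unifIcc δ) := by
  refine ProbabilityTheory.cond_isProbabilityMeasure_of_finite ?_ ?_
  · rw [Real.volume_Icc]
    simpa using hδ
  · simp [Real.volume_Icc]

lemma ae_mem_unifIcc (δ : ℝ) : ∀ᵐ x ∂unifIcc δ, x ∈ Set.Icc (-δ) δ :=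
  ProbabilityTheory.ae_cond_mem measurableSet_Icc

lemma integral_unifIcc {δ : ℝ} (hδ : 0 < δ) : ∫ x, x ∂unifIcc δ = 0 := by
  rw [unifIcc, ProbabilityTheory.cond, integral_smul_measure, integral_Icc_eq_integral_Ioc,
    ← intervalIntegral.integral_of_le (by linarith), integral_id]
  simp

lemma integral_exp_unifIcc_le {δ : ℝ} (hδ : 0 < δ) (hδ1 : δ ≤ 1) (t : ℝ) :
    ∫ x, Real.exp (x * t) ∂unifIcc δ ≤ Real.exp (t ^ 2 / 2) := by
  have := isProbabilityMeasure_unifIcc hδ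
  have h := (ProbabilityTheory.hasSubgaussianMGF_of_mem_Icc (X := fun x : ℝ => x)
    aemeasurable_id (ae_mem_unifIcc δ)).mgf_le t
  simp only [integral_unifIcc hδ, sub_zero, ProbabilityTheory.mgf] at h
  simp only [mul_comm _ t]
  refine h.trans (Real.exp_le_exp.2 ?_)
  have h2 : (((‖δ - -δ‖₊ / 2) ^ 2 : NNReal) : ℝ) = δ ^ 2 := by
    push_cast
    rw [Real.norm_eq_abs, abs_of_nonneg (by linarith)]
    ring
  rw [h2]
  have : δ ^ 2 ≤ 1 := pow_le_one₀ hδ.le hδ1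
  nlinarith [sq_nonneg t]

lemma unifIcc_closedBall {δ r : ℝ} (hδ : 0 < δ) (hr : r ≤ δ) :
    unifIcc δ (closedBall 0 r) = ENNReal.ofReal (r / δ) := by
  rw [unifIcc, ProbabilityTheory.cond_apply measurableSet_Icc, Set.inter_eq_right.2, Real.volume_Icc,
    Real.volume_closedBall, ← ENNReal.ofReal_inv_of_pos (by linarith),
    ← ENNReal.ofReal_mul (by rw [inv_nonneg]; linarith)]
  · congr 1
    field_simp
    ring
  · rw [Real.closedBall_eq_Icc]
    exact Set.Icc_subset_Icc (by linarith) (by linarith)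

lemma hasLocalDim_of_eventually_eq {X : Type*} [PseudoMetricSpace X] [MeasurableSpace X]
    {P : Measure X} {x : X} {d : ℕ} {c R : ℝ} (hc : 0 < c) (hR : 0 < R)
    (h : ∀ r, 0 < r → r ≤ R → (P (closedBall x r)).toReal = (r * c) ^ d) :
    HasLocalDim P x d := by
  have : (fun r : ℝ => (P (closedBall x r)).toReal / r ^ (d : ℝ))
      =ᶠ[nhdsWithin 0 (Set.Ioi 0)] fun _ => c ^ d := by
    filter_upwards [Ioc_mem_nhdsGT hR] with r hr
    rw [h r hr.1 hr.2, Real.rpow_natCast, mul_pow, mul_div_cancel_left₀]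
    exact (pow_pos hr.1 d).ne'
  rw [HasLocalDim, liminf_congr this, liminf_const]
  positivity

/-- The uniform distribution on the cube `[-δ, δ] ^ d`. -/
def unifCube (d : ℕ) (δ : ℝ) : Measure (Fin d → ℝ) := Measure.pi fun _ => unifIcc δ

section unifCube

variable {d : ℕ} {δ : ℝ}

lemma isProbabilityMeasure_unifCube (hδ : 0 < δ) : IsProbabilityMeasure (unifCube d δ) := by
  have := isProbabilityMeasure_unifIcc hδ
  unfold unifCube
  infer_instance

lemma ae_mem_unifCube (hδ : 0 < δ) (j : Fin d) : ∀ᵐ x ∂unifCube d δ, x j ∈ Set.Icc (-δ) δ := by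
  have := isProbabilityMeasure_unifIcc hδ
  exact (measurePreserving_eval (fun _ : Fin d => unifIcc δ) j).quasiMeasurePreserving.ae
    (ae_mem_unifIcc δ)

lemma hasLocalDim_unifCube (hδ : 0 < δ) : HasLocalDim (unifCube d δ) 0 (d : ℝ) := by
  have := isProbabilityMeasure_unifIcc hδ
  refine hasLocalDim_of_eventually_eq (inv_pos.2 hδ) hδ fun r hr hrδ => ?_
  rw [unifCube, Measure.pi_closedBall _ _ hr.le]
  simp only [Pi.zero_apply, unifIcc_closedBall hδ hrδ, Finset.prod_const, Finset.card_univ,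
    Fintype.card_fin, ENNReal.toReal_pow]
  rw [ENNReal.toReal_ofReal (by positivity), div_eq_mul_inv]

lemma subGaussianVec_unifCube (hδ : 0 < δ) (hδ1 : δ ≤ 1) : SubGaussianVec (unifCube d δ) := by
  have := isProbabilityMeasure_unifIcc hδ
  intro t
  simp only [Real.exp_sum, Finset.sum_div]
  rw [unifCube, integral_fintype_prod_eq_prod (fun j (y : ℝ) => Real.exp (y * t j))]
  exact Finset.prod_le_prod (fun j _ => integral_nonneg fun _ => (Real.exp_pos _).le)
    fun j _ => integral_exp_unifIcc_le hδ hδ1 (t j)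

lemma integral_unifCube (hδ : 0 < δ) (j : Fin d) : ∫ x, x j ∂unifCube d δ = 0 := by
  have := isProbabilityMeasure_unifIcc hδ
  have h := (measurePreserving_eval (fun _ : Fin d => unifIcc δ) j)
  have h' := integral_map (μ := Measure.pi fun _ : Fin d => unifIcc δ)
    (f := fun y : ℝ => y) h.measurable.aemeasurable
    measurable_id.aestronglyMeasurable
  rw [h.map_eq, integral_unifIcc hδ] at h'
  exact h'.symm

end unifCube

lemma subGaussianReal_dirac_zero : SubGaussianReal (Measure.dirac 0) := by
  intro t
  rw [integral_dirac]
  exact Real.exp_le_exp.2 (by rw [zero_mul]; positivity)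

/-! ### Cells of the cube -/

/-- The centers of the cells of the regular partition of the cube into `m ^ d` cells. -/
def cellCenter {d m : ℕ} (j : Fin d → Fin m) : Cube d := fun k =>
  ⟨(2 * (j k : ℝ) + 1) / (2 * m), by
    have hm : (0 : ℝ) < m := by exact_mod_cast (Nat.zero_le _).trans_lt (j k).2
    have hj : ((j k : ℕ) : ℝ) + 1 ≤ m := by exact_mod_cast (j k).2
    refine ⟨by positivity, (div_le_one (by positivity)).2 (by linarith)⟩⟩

lemma le_dist_cellCenter {d m : ℕ} {j j' : Fin d → Fin m} (h : j ≠ j') :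
    1 / (2 * (m : ℝ)) + 1 / (2 * m) ≤ dist (cellCenter j) (cellCenter j') := by
  obtain ⟨k, hk⟩ := Function.ne_iff.1 h
  refine le_trans ?_ (dist_le_pi_dist _ _ k)
  have hm : (0 : ℝ) < m := by exact_mod_cast (Nat.zero_le _).trans_lt (j k).2
  have h1 : (1 : ℝ) ≤ |((j k : ℕ) : ℝ) - ((j' k : ℕ) : ℝ)| := by
    have : (1 : ℤ) ≤ |((j k : ℕ) : ℤ) - ((j' k : ℕ) : ℤ)| :=
      Int.one_le_abs (sub_ne_zero.2 fun e => hk (Fin.ext (by exact_mod_cast e)))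
    exact_mod_cast this
  rw [Subtype.dist_eq, Real.dist_eq]
  simp only [cellCenter]
  rw [show (2 * ((j k : ℕ) : ℝ) + 1) / (2 * m) - (2 * ((j' k : ℕ) : ℝ) + 1) / (2 * m) =
    (((j k : ℕ) : ℝ) - ((j' k : ℕ) : ℝ)) / m by field_simp; ring, abs_div, abs_of_pos hm]
  rw [show 1 / (2 * (m : ℝ)) + 1 / (2 * m) = 1 / m by field_simp; ring]
  gcongr

lemma hasLocalDim_cellCenter {d m : ℕ} (hm : 0 < m) (j : Fin d → Fin m) :
    HasLocalDim (volume : Measure (Cube d)) (cellCenter j) (d : ℝ) := by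
  have hm' : (0 : ℝ) < m := by exact_mod_cast hm
  refine hasLocalDim_of_eventually_eq two_pos (R := 1 / (2 * m)) (by positivity) fun r hr hrm => ?_
  have key : ∀ k, (volume : Measure (Set.Icc (0 : ℝ) 1)) (closedBall (cellCenter j k) r) =
      ENNReal.ofReal (r * 2) := by
    intro k
    have himg : (Subtype.val '' closedBall (cellCenter j k) r) =
        closedBall (cellCenter j k : ℝ) r := by
      refine Set.Subset.antisymm (by rintro _ ⟨y, hy, rfl⟩; exact hy) fun y hy => ?_
      refine ⟨⟨y, ?_⟩, hy, rfl⟩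
      have hj : ((j k : ℕ) : ℝ) + 1 ≤ m := by exact_mod_cast (j k).2
      have hj0 : (0 : ℝ) ≤ (j k : ℕ) := Nat.cast_nonneg _
      rw [Real.closedBall_eq_Icc] at hy
      simp only [cellCenter] at hy
      have e1 : (2 * ((j k : ℕ) : ℝ) + 1) / (2 * m) - 1 / (2 * m) = (j k : ℕ) / m := by
        field_simp; ring
      have e2 : (2 * ((j k : ℕ) : ℝ) + 1) / (2 * m) + 1 / (2 * m) = ((j k : ℕ) + 1) / m := by
        field_simp; ring
      have e3 : (((j k : ℕ) : ℝ) + 1) / m ≤ 1 := (div_le_one hm').2 hj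
      have e4 : (0 : ℝ) ≤ (j k : ℕ) / m := by positivity
      exact ⟨by linarith [hy.1], by linarith [hy.2]⟩
    rw [Measure.Subtype.volume_def, comap_subtype_coe_apply measurableSet_Icc, himg,
      Real.volume_closedBall, mul_comm]
  rw [volume_pi, Measure.pi_closedBall _ _ hr.le]
  simp only [key, Finset.prod_const, Finset.card_univ, Fintype.card_fin, ENNReal.toReal_pow]
  rw [ENNReal.toReal_ofReal (by positivity)]

/-! ### The two-point argument -/

/-- Among at least `2 * n` cells there is one which `n` random points avoid with probability at
least `1 / 2`; on that event no estimate is close to both `b` and `-b`. -/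
lemma exists_cell_sign {Ω : Type*} [MeasurableSpace Ω] (P : Measure Ω) [IsProbabilityMeasure P]
    {n d m : ℕ} (hm : 2 * n ≤ m ^ d) (hm0 : 0 < m) {V : Fin n → Ω → Cube d}
    (hV : ∀ i, Measurable (V i)) (E : Ω → ℝ) (b : ℝ) :
    ∃ (j : Fin d → Fin m) (ε : ℝ), |ε| = 1 ∧
      1 / 4 ≤ P.real {ω | (∀ i, 1 / (2 * (m : ℝ)) ≤ dist (V i ω) (cellCenter j)) ∧
        b ≤ |E ω - ε * b|} := by
  set w : ℝ := 1 / (2 * (m : ℝ)) with hw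
  obtain ⟨j, hj⟩ : ∃ j : Fin d → Fin m,
      P.real (⋃ i, V i ⁻¹' ball (cellCenter j) w) ≤ 1 / 2 := by
    by_contra! h
    have : Nonempty (Fin d → Fin m) := ⟨fun _ => ⟨0, hm0⟩⟩
    have h1 : ∑ j : Fin d → Fin m, (1 / 2 : ℝ) <
        ∑ j : Fin d → Fin m, ∑ i, P.real (V i ⁻¹' ball (cellCenter j) w) :=
      Finset.sum_lt_sum_of_nonempty Finset.univ_nonempty fun j _ =>
        (h j).trans_le (measureReal_iUnion_fintype_le _)
    have h2 : ∀ i, ∑ j : Fin d → Fin m, P.real (V i ⁻¹' ball (cellCenter j) w) ≤ 1 := fun i =>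
      (sum_measureReal_le_measureReal_univ (fun j _ => hV i measurableSet_ball)
        fun j _ j' _ hjj' => (ball_disjoint_ball (le_dist_cellCenter hjj')).preimage _).trans_eq
          probReal_univ
    rw [Finset.sum_comm] at h1
    have h3 := h1.trans_le (Finset.sum_le_sum fun i _ => h2 i)
    simp only [Finset.sum_const, Finset.card_univ, Fintype.card_pi, Fintype.card_fin,
      Finset.prod_const, nsmul_eq_mul, mul_one] at h3
    have h4 : (2 : ℝ) * n ≤ ((m ^ d : ℕ) : ℝ) := by exact_mod_cast hm
    linarith
  by_contra! h
  have hcov : (Set.univ : Set Ω) ⊆ (⋃ i, V i ⁻¹' ball (cellCenter j) w) ∪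
      ({ω | (∀ i, w ≤ dist (V i ω) (cellCenter j)) ∧ b ≤ |E ω - 1 * b|} ∪
        {ω | (∀ i, w ≤ dist (V i ω) (cellCenter j)) ∧ b ≤ |E ω - -1 * b|}) := by
    intro ω _
    by_cases hω : ∀ i, w ≤ dist (V i ω) (cellCenter j)
    · right
      rcases le_total (E ω) 0 with h0 | h0
      · exact Or.inl ⟨hω, le_abs.2 (Or.inr (by linarith))⟩
      · exact Or.inr ⟨hω, le_abs.2 (Or.inl (by linarith))⟩
    · left
      push Not at hω
      exact Set.mem_iUnion.2 hω
  have h1 := (measureReal_mono (μ := P) hcov).trans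
    ((measureReal_union_le _ _).trans (add_le_add_right (measureReal_union_le _ _) _))
  rw [probReal_univ] at h1
  linarith [h j 1 (by simp), h j (-1) (by simp)]

/-- Geometric scales: `m ^ d` cells of side `1 / m` suffice for `n` queries, and the dip of a
cell exceeds the radius `ρ` of a peak of the required height, with room for noise of size `δ`. -/
lemma exists_scales {sg sf Lg : ℝ} (hsg : sg ∈ Set.Ioc (0 : ℝ) 1) (hsf : sf ∈ Set.Ioc (0 : ℝ) 1)
    (hLg : 0 < Lg) {d n : ℕ} (hd : 0 < d) (hn : 0 < n) {σ : ℝ} (hσ : 0 ≤ σ) :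
    ∃ (m : ℕ) (ρ δ : ℝ), 0 < m ∧ 2 * n ≤ m ^ d ∧ 0 ≤ ρ ∧ 0 < δ ∧ δ ≤ 1 ∧
      ρ ^ sf = Lg ^ sf / (2 * ((2 * (n : ℝ)) ^ (sf * sg / (d : ℝ)) + 1)) ∧
      ρ + σ * δ ≤ Lg * (1 / (2 * (m : ℝ))) ^ sg := by
  have hn' : (0 : ℝ) < n := by exact_mod_cast hn
  have hd' : (0 : ℝ) < d := by exact_mod_cast hd
  set a : ℝ := sf * sg with ha
  have ha0 : 0 < a := mul_pos hsf.1 hsg.1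
  have ha1 : a ≤ 1 := mul_le_one₀ hsf.2 hsg.1.le hsg.2
  set x : ℝ := (2 * (n : ℝ)) ^ (1 / (d : ℝ)) with hx
  have hx0 : 0 < x := by positivity
  have hxa : (2 * (n : ℝ)) ^ (a / (d : ℝ)) = x ^ a := by
    rw [hx, ← Real.rpow_mul (by positivity)]
    congr 1
    ring
  have hxd : x ^ d = 2 * n := by
    rw [hx, ← Real.rpow_natCast, ← Real.rpow_mul (by positivity), one_div_mul_cancel hd'.ne',
      Real.rpow_one]
  set m : ℕ := ⌈x⌉₊ with hm
  have hm0 : 0 < m := Nat.ceil_pos.2 hx0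
  have hm' : (0 : ℝ) < m := by exact_mod_cast hm0
  rw [hxa]
  set B : ℝ := 2 * (x ^ a + 1) with hB
  have hB0 : 0 < B := by positivity
  have hmB : (2 * (m : ℝ)) ^ a < B := calc
    (2 * (m : ℝ)) ^ a < (2 * (x + 1)) ^ a :=
      Real.rpow_lt_rpow (by positivity) (by linarith [Nat.ceil_lt_add_one hx0.le]) ha0
    _ = 2 ^ a * (x + 1) ^ a := Real.mul_rpow two_pos.le (by positivity)
    _ ≤ 2 * (x ^ a + 1) := by
      gcongr
      · exact (Real.rpow_le_rpow_of_exponent_le one_le_two ha1).trans_eq (Real.rpow_one 2)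
      · simpa using Real.rpow_add_le_add_rpow hx0.le zero_le_one ha0.le ha1
  set M : ℝ := Lg * (1 / (2 * (m : ℝ))) ^ sg with hM
  have hM0 : 0 < M := by positivity
  set ρ : ℝ := (Lg ^ sf / B) ^ (1 / sf) with hρ
  have hρ0 : 0 ≤ ρ := by positivity
  have hρsf : ρ ^ sf = Lg ^ sf / B := by
    rw [hρ, ← Real.rpow_mul (by positivity), one_div_mul_cancel hsf.1.ne', Real.rpow_one]
  have hρM : ρ < M := by
    refine lt_of_not_ge fun hle => ?_
    have h1 := Real.rpow_le_rpow hM0.le hle hsf.1.le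
    rw [hρsf, hM, Real.mul_rpow hLg.le (by positivity), ← Real.rpow_mul (by positivity),
      mul_comm sg, ← ha, Real.div_rpow zero_le_one (by positivity), Real.one_rpow, mul_one_div]
      at h1
    exact h1.not_gt (div_lt_div_of_pos_left (by positivity) (by positivity) hmB)
  refine ⟨m, ρ, min 1 ((M - ρ) / (σ + 1)), hm0, ?_, hρ0, lt_min one_pos
    (div_pos (sub_pos.2 hρM) (by linarith)), min_le_left _ _, hρsf, ?_⟩
  · have : (2 : ℝ) * n ≤ (m : ℝ) ^ d := by
      rw [← hxd]
      gcongr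
      exact Nat.le_ceil x
    exact_mod_cast this
  · have h1 : σ * min 1 ((M - ρ) / (σ + 1)) ≤ σ * ((M - ρ) / (σ + 1)) :=
      mul_le_mul_of_nonneg_left (min_le_right _ _) hσ
    have h2 : σ * ((M - ρ) / (σ + 1)) ≤ M - ρ := by
      rw [← mul_div_assoc, div_le_iff₀ (by linarith)]
      nlinarith
    linarith

/-! ### Observations that do not reach the dip -/

/-- The response of the model to a query outside the dip of height `M`, given the noise `e`. -/
def baseObs {d : ℕ} (M σX σY : ℝ) (x0 : Fin d → ℝ) (e : (Fin d → ℝ) × ℝ) : (Fin d → ℝ) × ℝ :=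
  ((fun j => x0 j + M) + σX • e.1, σY * e.2)

lemma measurable_baseObs {d : ℕ} (M σX σY : ℝ) (x0 : Fin d → ℝ) :
    Measurable (baseObs M σX σY x0) := by
  unfold baseObs
  fun_prop

section Observations

variable {Z : Type*} [PseudoMetricSpace Z] {d : ℕ} {sg sf Lg Lf w ρ δ σX : ℝ} {x0 : Fin d → ℝ}
  {z0 z : Z}

lemma dip_add_eq_baseObs (hLg : 0 ≤ Lg) (hsg : 0 < sg) (hw : 0 ≤ w) (hz : w ≤ dist z z0)
    (σY : ℝ) (e : (Fin d → ℝ) × ℝ) :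
    dip Lg sg w x0 z0 z + σX • e.1 = (baseObs (Lg * w ^ sg) σX σY x0 e).1 := by
  ext j
  simp only [baseObs, Pi.add_apply, dip, truncDistPow_of_le_dist hLg hsg hw hz]

lemma peak_baseObs_eq_zero (hLf : 0 ≤ Lf) (hsf : 0 < sf) (hρ : 0 ≤ ρ) (hσX : 0 ≤ σX) {M : ℝ}
    (hM : ρ + σX * δ ≤ M) (σY ε : ℝ) {e : (Fin d → ℝ) × ℝ} {j : Fin d}
    (he : e.1 j ∈ Set.Icc (-δ) δ) :
    peak Lf sf ρ ε x0 (baseObs M σX σY x0 e).1 = 0 := by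
  have h : ρ ≤ dist (baseObs M σX σY x0 e).1 x0 := by
    refine le_trans ?_ (dist_le_pi_dist _ _ j)
    rw [Real.dist_eq]
    refine le_abs.2 (Or.inl ?_)
    simp only [baseObs, Pi.add_apply, Pi.smul_apply, smul_eq_mul]
    nlinarith [mul_le_mul_of_nonneg_left he.1 hσX]
  rw [peak, truncDistPow_of_le_dist hLf hsf hρ h, sub_self, mul_zero]

end Observations

/-! ### Queries of an active learner -/

section Active

variable {n : ℕ} {A W U N : Type*}

/-- The queries of an active learner with strategy `ζ` whose `i`-th response is `obs (e i)`,
whatever the queries are. -/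
def baseQuery (ζ : (i : Fin n) → (Fin (i : ℕ) → A × W) → U → A) (obs : N → W) :
    (i : ℕ) → i < n → U × (Fin n → N) → A
  | i, hi, ω => ζ ⟨i, hi⟩ (fun j : Fin i =>
      (baseQuery ζ obs j (j.2.trans hi) ω, obs (ω.2 ⟨j, j.2.trans hi⟩))) ω.1
termination_by i => i
decreasing_by exact j.2

lemma measurable_baseQuery [MeasurableSpace A] [MeasurableSpace W] [MeasurableSpace U]
    [MeasurableSpace N] {ζ : (i : Fin n) → (Fin (i : ℕ) → A × W) → U → A} {obs : N → W}
    (hζ : ∀ i : Fin n, Measurable fun p : (Fin (i : ℕ) → A × W) × U => ζ i p.1 p.2)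
    (hobs : Measurable obs) (i : ℕ) (hi : i < n) : Measurable (baseQuery ζ obs i hi) := by
  induction i using Nat.strong_induction_on with
  | _ i ih =>
    have h : baseQuery ζ obs i hi = fun ω => ζ ⟨i, hi⟩ (fun j : Fin i =>
        (baseQuery ζ obs j (j.2.trans hi) ω, obs (ω.2 ⟨j, j.2.trans hi⟩))) ω.1 := by
      funext ω
      rw [baseQuery]
    rw [h]
    refine (hζ ⟨i, hi⟩).comp (Measurable.prodMk (measurable_pi_lambda _ fun j => ?_) measurable_fst)
    exact (ih j j.2 _).prodMk (hobs.comp ((measurable_pi_apply _).comp measurable_snd))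

/-- As long as the responses follow `obs` at the queries of `baseQuery`, the queries agree with
`baseQuery`. -/
lemma eq_baseQuery {ζ : (i : Fin n) → (Fin (i : ℕ) → A × W) → U → A} {obs : N → W}
    {Q : Fin n → A} {R : Fin n → W} {ω : U × (Fin n → N)}
    (hQ : ∀ i, Q i = ζ i (fun j => (Q ⟨(j : ℕ), j.2.trans i.2⟩, R ⟨(j : ℕ), j.2.trans i.2⟩)) ω.1)
    (hR : ∀ i : Fin n, Q i = baseQuery ζ obs i i.2 ω → R i = obs (ω.2 i)) (i : Fin n) :
    Q i = baseQuery ζ obs i i.2 ω := by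
  obtain ⟨i, hi⟩ := i
  induction i using Nat.strong_induction_on with
  | _ i ih =>
    rw [hQ, baseQuery]
    congr 1
    funext j
    have hj := ih j j.2 (j.2.trans hi)
    exact Prod.ext hj (hR _ hj)

end Active

/-- **Proposition 2 (Minimax lower bound without noise, passive and active cases).**
For both passive estimators (first conjunct) and active estimators (second conjunct),
some model satisfying the assumptions forces error at least
`L_f L_g^{s_f} / (2 ‖K_{d_X}‖_{C^{s_f}} ‖K_{d_Z}‖_{C^{s_g}}^{s_f} ((2n)^{s_f s_g/d_Z} + 1))`
with probability at least `2^{-(d_Z+2)}`. -/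
theorem lower_bound_no_noise
    (sg sf Lg Lf : ℝ) (dX dZ : ℕ)
    (hsg : sg ∈ Set.Ioc (0:ℝ) 1) (hsf : sf ∈ Set.Ioc (0:ℝ) 1)
    (hLg : 0 < Lg) (hLf : 0 < Lf) (hdX : 0 < dX) (hdZ : 0 < dZ) :
    -- passive case
    (∀ (n : ℕ), 0 < n →
      ∀ (σX σY : ℝ), 0 ≤ σX → 0 ≤ σY →
      ∀ x0 : Fin dX → ℝ,
      ∀ (U : Type) [MeasurableSpace U] (PU : Measure U) [IsProbabilityMeasure PU]
        (fhat : (Fin n → Cube dZ × (Fin dX → ℝ) × ℝ) → U → ℝ),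
        Measurable (fun p : (Fin n → Cube dZ × (Fin dX → ℝ) × ℝ) × U => fhat p.1 p.2) →
      ∃ (g : Cube dZ → Fin dX → ℝ) (f : (Fin dX → ℝ) → ℝ)
        (PZ : Measure (Cube dZ)) (PeX : Measure (Fin dX → ℝ)) (PeY : Measure ℝ),
        IsProbabilityMeasure PZ ∧ IsProbabilityMeasure PeX ∧ IsProbabilityMeasure PeY ∧
        GlobHolderBall sg Lg g ∧ GlobHolderBall sf Lf f ∧
        (∃ z0 : Cube dZ, g z0 = x0 ∧ HasLocalDim PZ z0 (dZ : ℝ)) ∧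
        HasLocalDim PeX 0 (dX : ℝ) ∧
        SubGaussianVec PeX ∧ SubGaussianReal PeY ∧
        (∀ j, ∫ x, x j ∂PeX = 0) ∧ (∫ y, y ∂PeY = 0) ∧
        (1 : ℝ) / 2 ^ (dZ + 2) ≤
          (((Measure.pi fun _ : Fin n => PZ.prod (PeX.prod PeY)).prod PU)
            {p | Lf * Lg ^ sf / (2 * holderSeminorm sf (bumpFn dX) * holderSeminorm sg (bumpFn dZ) ^ sf * ((2 * (n : ℝ)) ^ (sf * sg / (dZ : ℝ)) + 1)) ≤
              |fhat (fun i =>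
                  ((p.1 i).1,
                    g ((p.1 i).1) + σX • (p.1 i).2.1,
                    f (g ((p.1 i).1) + σX • (p.1 i).2.1) + σY * (p.1 i).2.2)) p.2
                - f x0|}).toReal)
    ∧
    -- active case
    (∀ (n : ℕ), 0 < n →
      ∀ (σX σY : ℝ), 0 ≤ σX → 0 ≤ σY →
      ∀ x0 : Fin dX → ℝ,
      ∀ (U : Type) [MeasurableSpace U] (PU : Measure U) [IsProbabilityMeasure PU]
        (ζ : (i : Fin n) → (Fin (i : ℕ) → Cube dZ × (Fin dX → ℝ) × ℝ) → U → Cube dZ)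
        (est : (Fin n → Cube dZ × (Fin dX → ℝ) × ℝ) → U → ℝ),
        (∀ i : Fin n, Measurable
          (fun p : (Fin (i : ℕ) → Cube dZ × (Fin dX → ℝ) × ℝ) × U => ζ i p.1 p.2)) →
        Measurable (fun p : (Fin n → Cube dZ × (Fin dX → ℝ) × ℝ) × U => est p.1 p.2) →
      ∃ (g : Cube dZ → Fin dX → ℝ) (f : (Fin dX → ℝ) → ℝ)
        (PZ : Measure (Cube dZ)) (PeX : Measure (Fin dX → ℝ)) (PeY : Measure ℝ),
        IsProbabilityMeasure PZ ∧ IsProbabilityMeasure PeX ∧ IsProbabilityMeasure PeY ∧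
        GlobHolderBall sg Lg g ∧ GlobHolderBall sf Lf f ∧
        (∃ z0 : Cube dZ, g z0 = x0 ∧ HasLocalDim PZ z0 (dZ : ℝ)) ∧
        HasLocalDim PeX 0 (dX : ℝ) ∧
        SubGaussianVec PeX ∧ SubGaussianReal PeY ∧
        (∀ j, ∫ x, x j ∂PeX = 0) ∧ (∫ y, y ∂PeY = 0) ∧
        ∀ (Z : Fin n → U × (Fin n → (Fin dX → ℝ) × ℝ) → Cube dZ)
          (X : Fin n → U × (Fin n → (Fin dX → ℝ) × ℝ) → (Fin dX → ℝ))
          (Y : Fin n → U × (Fin n → (Fin dX → ℝ) × ℝ) → ℝ),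
          (∀ i ω, Z i ω = ζ i (fun j =>
              (Z ⟨(j : ℕ), j.2.trans i.2⟩ ω,
               X ⟨(j : ℕ), j.2.trans i.2⟩ ω,
               Y ⟨(j : ℕ), j.2.trans i.2⟩ ω)) ω.1) →
          (∀ i ω, X i ω = g (Z i ω) + σX • (ω.2 i).1) →
          (∀ i ω, Y i ω = f (X i ω) + σY * (ω.2 i).2) →
          (1 : ℝ) / 2 ^ (dZ + 2) ≤
            ((PU.prod (Measure.pi fun _ : Fin n => PeX.prod PeY))
              {ω | Lf * Lg ^ sf / (2 * holderSeminorm sf (bumpFn dX) * holderSeminorm sg (bumpFn dZ) ^ sf * ((2 * (n : ℝ)) ^ (sf * sg / (dZ : ℝ)) + 1)) ≤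
                |est (fun i => (Z i ω, X i ω, Y i ω)) ω.1 - f x0|}).toReal) := by
  have hquarter : (1 : ℝ) / 2 ^ (dZ + 2) ≤ 1 / 4 := by
    refine one_div_le_one_div_of_le (by norm_num) ?_
    rw [pow_add]
    linarith [one_le_pow₀ (one_le_two (α := ℝ)) (n := dZ)]
  have hthr : ∀ n : ℕ, Lf * Lg ^ sf / (2 * holderSeminorm sf (bumpFn dX) *
      holderSeminorm sg (bumpFn dZ) ^ sf * ((2 * (n : ℝ)) ^ (sf * sg / (dZ : ℝ)) + 1)) ≤
      Lf * (Lg ^ sf / (2 * ((2 * (n : ℝ)) ^ (sf * sg / (dZ : ℝ)) + 1))) := fun n =>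
    threshold_le hsf.1 hLg hLf hdX hdZ (by positivity)
  have j0 : Fin dX := ⟨0, hdX⟩
  have hpeak : ∀ (ρ ε : ℝ), 0 ≤ ρ → ∀ x0 : Fin dX → ℝ,
      peak Lf sf ρ ε x0 x0 = ε * (Lf * ρ ^ sf) := fun ρ ε hρ x0 => by
    rw [peak, truncDistPow_self hLf.le hsf.1 hρ, sub_zero]
  have hdip : ∀ w : ℝ, 0 ≤ w → ∀ (x0 : Fin dX → ℝ) (z0 : Cube dZ),
      dip Lg sg w x0 z0 z0 = x0 := fun w hw x0 z0 => by
    ext j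
    rw [dip, truncDistPow_self hLg.le hsg.1 hw, add_zero]
  constructor
  · intro n hn σX σY hσX _ x0 U _ PU _ fhat _
    obtain ⟨m, ρ, δ, hm, hmn, hρ, hδ, hδ1, hρsf, hM⟩ := exists_scales hsg hsf hLg hdZ hn hσX
    have hw : (0 : ℝ) ≤ 1 / (2 * (m : ℝ)) := by positivity
    have := isProbabilityMeasure_unifCube (d := dX) hδ
    obtain ⟨j, ε, hε, hP⟩ := exists_cell_sign
      ((Measure.pi fun _ : Fin n => (volume : Measure (Cube dZ)).prod
        ((unifCube dX δ).prod (Measure.dirac (0 : ℝ)))).prod PU) hmn hm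
      (V := fun i p => (p.1 i).1)
      (fun i => ((measurable_pi_apply i).comp measurable_fst).fst)
      (fun p => fhat (fun i => ((p.1 i).1,
        baseObs (Lg * (1 / (2 * (m : ℝ))) ^ sg) σX σY x0 (p.1 i).2)) p.2) (Lf * ρ ^ sf)
    refine ⟨dip Lg sg (1 / (2 * (m : ℝ))) x0 (cellCenter j), peak Lf sf ρ ε x0, volume,
      unifCube dX δ, Measure.dirac 0, inferInstance, this, inferInstance,
      globHolderBall_dip hLg.le hsg _ _ _, globHolderBall_peak hLf.le hsf hε _ _,
      ⟨cellCenter j, hdip _ hw _ _, hasLocalDim_cellCenter hm j⟩, hasLocalDim_unifCube hδ,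
      subGaussianVec_unifCube hδ hδ1, subGaussianReal_dirac_zero, integral_unifCube hδ,
      integral_dirac _ _, hquarter.trans (hP.trans (ENNReal.toReal_mono (measure_ne_top _ _)
        (measure_mono_ae ?_)))⟩
    have hnoise : ∀ᵐ p ∂((Measure.pi fun _ : Fin n => (volume : Measure (Cube dZ)).prod
        ((unifCube dX δ).prod (Measure.dirac (0 : ℝ)))).prod PU),
        ∀ i, (p.1 i).2.1 j0 ∈ Set.Icc (-δ) δ :=
      ae_all_iff.2 fun i => (Measure.quasiMeasurePreserving_fst.comp
        (Measure.quasiMeasurePreserving_snd.comp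
          ((measurePreserving_eval _ i).quasiMeasurePreserving.comp
            Measure.quasiMeasurePreserving_fst))).ae (ae_mem_unifCube hδ j0)
    filter_upwards [hnoise] with p hp hpV
    obtain ⟨hfar, hE⟩ := hpV
    refine (hthr n).trans ?_
    rw [← hρsf, hpeak ρ ε hρ]
    refine hE.trans_eq ?_
    congr 3
    funext i
    rw [dip_add_eq_baseObs hLg.le hsg.1 hw (hfar i) σY,
      peak_baseObs_eq_zero hLf.le hsf.1 hρ hσX hM σY ε (hp i), zero_add]
    rfl
  · intro n hn σX σY hσX _ x0 U _ PU _ ζ est hζ _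
    obtain ⟨m, ρ, δ, hm, hmn, hρ, hδ, hδ1, hρsf, hM⟩ := exists_scales hsg hsf hLg hdZ hn hσX
    have hw : (0 : ℝ) ≤ 1 / (2 * (m : ℝ)) := by positivity
    have := isProbabilityMeasure_unifCube (d := dX) hδ
    set obs := baseObs (Lg * (1 / (2 * (m : ℝ))) ^ sg) σX σY x0 with hobs
    obtain ⟨j, ε, hε, hP⟩ := exists_cell_sign
      (PU.prod (Measure.pi fun _ : Fin n => (unifCube dX δ).prod (Measure.dirac (0 : ℝ)))) hmn hm
      (V := fun i => baseQuery ζ obs i i.2)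
      (fun i => measurable_baseQuery hζ (measurable_baseObs _ _ _ _) i i.2)
      (fun ω => est (fun i => (baseQuery ζ obs i i.2 ω, obs (ω.2 i))) ω.1) (Lf * ρ ^ sf)
    refine ⟨dip Lg sg (1 / (2 * (m : ℝ))) x0 (cellCenter j), peak Lf sf ρ ε x0, volume,
      unifCube dX δ, Measure.dirac 0, inferInstance, this, inferInstance,
      globHolderBall_dip hLg.le hsg _ _ _, globHolderBall_peak hLf.le hsf hε _ _,
      ⟨cellCenter j, hdip _ hw _ _, hasLocalDim_cellCenter hm j⟩, hasLocalDim_unifCube hδ,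
      subGaussianVec_unifCube hδ hδ1, subGaussianReal_dirac_zero, integral_unifCube hδ,
      integral_dirac _ _, fun Z X Y hZ hX hY => hquarter.trans (hP.trans
        (ENNReal.toReal_mono (measure_ne_top _ _) (measure_mono_ae ?_)))⟩
    have hnoise : ∀ᵐ ω ∂(PU.prod (Measure.pi fun _ : Fin n =>
        (unifCube dX δ).prod (Measure.dirac (0 : ℝ)))), ∀ i, (ω.2 i).1 j0 ∈ Set.Icc (-δ) δ :=
      ae_all_iff.2 fun i => (Measure.quasiMeasurePreserving_fst.comp
        ((measurePreserving_eval _ i).quasiMeasurePreserving.comp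
          Measure.quasiMeasurePreserving_snd)).ae (ae_mem_unifCube hδ j0)
    filter_upwards [hnoise] with ω hω hωV
    obtain ⟨hfar, hE⟩ := hωV
    refine (hthr n).trans ?_
    rw [← hρsf, hpeak ρ ε hρ]
    refine hE.trans_eq ?_
    have hR : ∀ i : Fin n, Z i ω = baseQuery ζ obs i i.2 ω → (X i ω, Y i ω) = obs (ω.2 i) := by
      intro i hi
      have hXi : X i ω = (obs (ω.2 i)).1 := by
        rw [hX, dip_add_eq_baseObs hLg.le hsg.1 hw (hi ▸ hfar i) σY]
      refine Prod.ext hXi ?_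
      rw [hY, hXi, peak_baseObs_eq_zero hLf.le hsf.1 hρ hσX hM σY ε (hω i), zero_add]
      rfl
    have hQ := eq_baseQuery (Q := fun i => Z i ω) (R := fun i => (X i ω, Y i ω))
      (fun i => hZ i ω) hR
    congr 3
    funext i
    rw [← hR i (hQ i), ← hQ i]

end
end

section
/- (Active minimax lower bound, large covariate and response noise; Proposition 4.) With 𝒵 = [0,1]^{d_Z} and 𝒳 = ℝ^{d_X}, for every active estimator f̂_{x_0} (any sequential procedure in which each Z_i is a measurable, possibly randomized, function of the previous observations {(Z_j, X_j, Y_j)}_{j<i}, and the final estimate is measurable in the full dataset), the supremum over all g, f, P_Z, ε_X, ε_Y satisfying the assumptions of P[ |f̂_{x_0} − f(x_0)| ≥ C (σ_X^{d_X} σ_Y²/n)^{s_f/(2 s_f + d_X)} ] is at least 1/4, where C > 0 depends only on L_f, s_f, and d_X; explicitly one may take the threshold to be (1/2)(L_f/‖K_{d_X}‖_{C^{s_f}})^{d_X/(2s_f + d_X)} (4 √(d_X^{d_X}))^{−s_f/(2s_f + d_X)} (σ_X^{d_X} σ_Y²/n)^{s_f/(2s_f + d_X)}. The supremum is over g in the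 global Hölder ball C^{s_g}(𝒵; 𝒳; L_g) with g(z_0) = x_0 for some z_0 around which P_Z has local dimension d_Z, f in the global Hölder ball C^{s_f}(𝒳; ℝ; L_f), distributions P_Z, sub-Gaussian ε_X with local dimension d_X around 0, and sub-Gaussian ε_Y. -/
open MeasureTheory Filter Metric

noncomputable section

theorem lintegral_pi_prod {ι : Type*} [Fintype ι] {E : ι → Type*} [∀ i, MeasurableSpace (E i)]
    (μ : ∀ i, Measure (E i)) [∀ i, IsProbabilityMeasure (μ i)] {f : ∀ i, E i → ENNReal}
    (hf : ∀ i, Measurable (f i)) :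
    ∫⁻ x, ∏ i, f i (x i) ∂Measure.pi μ = ∏ i, ∫⁻ y, f i y ∂μ i := by
  have hind := ProbabilityTheory.iIndepFun_pi (μ := μ) (X := f) fun i => (hf i).aemeasurable
  rw [ProbabilityTheory.lintegral_prod_eq_prod_lintegral_of_indepFun Finset.univ _ hind
    fun i => (hf i).comp (measurable_pi_apply i)]
  exact Finset.prod_congr rfl fun i _ => (measurePreserving_eval μ i).lintegral_comp (hf i)

theorem pi_withDensity {ι : Type*} [Fintype ι] {E : ι → Type*} [∀ i, MeasurableSpace (E i)]
    (μ : ∀ i, Measure (E i)) [∀ i, IsProbabilityMeasure (μ i)] {f : ∀ i, E i → ENNReal}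
    (hf : ∀ i, Measurable (f i)) [∀ i, SigmaFinite ((μ i).withDensity (f i))] :
    Measure.pi (fun i => (μ i).withDensity (f i)) =
      (Measure.pi μ).withDensity fun x => ∏ i, f i (x i) := by
  refine Measure.pi_eq fun s hs => ?_
  rw [withDensity_apply _ (MeasurableSet.univ_pi hs),
    ← lintegral_indicator (MeasurableSet.univ_pi hs)]
  have h : ((Set.univ.pi s).indicator fun x : ∀ i, E i => ∏ i, f i (x i)) =
      fun x => ∏ i, (s i).indicator (f i) (x i) := by
    funext x
    by_cases hx : x ∈ Set.univ.pi s
    · rw [Set.indicator_of_mem hx]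
      exact Finset.prod_congr rfl fun i _ => (Set.indicator_of_mem (hx i trivial) _).symm
    · rw [Set.indicator_of_notMem hx]
      obtain ⟨i, hi⟩ : ∃ i, x i ∉ s i := by simpa [Set.mem_pi] using hx
      exact (Finset.prod_eq_zero (Finset.mem_univ i) (Set.indicator_of_notMem hi _)).symm
  rw [h, lintegral_pi_prod μ fun i => (hf i).indicator (hs i)]
  exact Finset.prod_congr rfl fun i _ => by
    rw [withDensity_apply _ (hs i), lintegral_indicator (hs i)]

theorem gaussianReal_eq_withDensity (m : ℝ) :
    ProbabilityTheory.gaussianReal m 1 = (ProbabilityTheory.gaussianReal 0 1).withDensity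
      fun y => ENNReal.ofReal (Real.exp (m * y / 2 - m ^ 2 / 4)) ^ 2 := by
  rw [ProbabilityTheory.gaussianReal_of_var_ne_zero _ one_ne_zero,
    ProbabilityTheory.gaussianReal_of_var_ne_zero _ one_ne_zero,
    ← withDensity_mul _ (by fun_prop) (by fun_prop)]
  congr 1
  funext y
  simp only [Pi.mul_apply, ProbabilityTheory.gaussianPDF, ProbabilityTheory.gaussianPDFReal]
  rw [← ENNReal.ofReal_pow (Real.exp_nonneg _), ← ENNReal.ofReal_mul (by positivity), ← Real.exp_nat_mul,
    mul_assoc _ (Real.exp _), ← Real.exp_add]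
  congr 3
  push_cast
  ring

theorem map_shear_gaussianReal {E : Type*} [MeasurableSpace E] (P : Measure E)
    [IsProbabilityMeasure P] {φ : E → ℝ} (hφ : Measurable φ) :
    (P.prod (ProbabilityTheory.gaussianReal 0 1)).map (fun p => (p.1, p.2 + φ p.1)) =
      (P.prod (ProbabilityTheory.gaussianReal 0 1)).withDensity
        fun p => ENNReal.ofReal (Real.exp (φ p.1 * p.2 / 2 - φ p.1 ^ 2 / 4)) ^ 2 := by
  have hS : Measurable fun p : E × ℝ => (p.1, p.2 + φ p.1) := by fun_prop
  ext s hs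
  rw [Measure.map_apply hS hs, Measure.prod_apply (hS hs), withDensity_apply _ hs,
    ← lintegral_indicator hs, lintegral_prod _ (by
      refine (Measurable.indicator ?_ hs).aemeasurable
      fun_prop)]
  refine lintegral_congr fun x => ?_
  have hsx : MeasurableSet (Prod.mk x ⁻¹' s) := measurable_prodMk_left hs
  have h : ProbabilityTheory.gaussianReal (φ x) 1 (Prod.mk x ⁻¹' s) =
      ProbabilityTheory.gaussianReal 0 1
        (Prod.mk x ⁻¹' ((fun p : E × ℝ => (p.1, p.2 + φ p.1)) ⁻¹' s)) := by
    conv_lhs => rw [← zero_add (φ x), ← ProbabilityTheory.gaussianReal_map_add_const,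
      Measure.map_apply (by fun_prop) hsx]
    rfl
  rw [← h, gaussianReal_eq_withDensity, withDensity_apply _ hsx, ← lintegral_indicator hsx]
  rfl

theorem measure_preimage_le_of_affinity {Ω : Type*} [MeasurableSpace Ω] (μ : Measure Ω)
    [IsProbabilityMeasure μ] {T : Ω → Ω} (hT : Measurable T) {R : Ω → ENNReal} (hR : Measurable R)
    (hmap : μ.map T = μ.withDensity fun ω => R ω ^ 2)
    (haff : ENNReal.ofReal (31 / 32) ≤ ∫⁻ ω, R ω ∂μ)
    {A : Set Ω} (hA : MeasurableSet A) (hμA : μ.real A ≤ 1 / 4) :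
    μ.real (T ⁻¹' A) ≤ 3 / 4 := by
  have hν (B : Set Ω) (hB : MeasurableSet B) :
      ∫⁻ ω in B, R ω ^ 2 ∂μ = ENNReal.ofReal (μ.real (T ⁻¹' B)) := by
    rw [← withDensity_apply _ hB, ← hmap, Measure.map_apply hT hB, ofReal_measureReal]
  have h1 (x : ENNReal) : x ≤ 1 + ENNReal.ofReal (1 / 4) * x ^ 2 := by
    induction x with
    | top => simp
    | coe x =>
      rw [← ENNReal.toReal_le_toReal (by simp) (by finiteness),
        ENNReal.toReal_add (by simp) (by finiteness)]
      simp
      nlinarith [sq_nonneg ((x : ℝ) - 2)]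
  have h2 (x : ENNReal) : x ≤ ENNReal.ofReal (1 / 4) + x ^ 2 := by
    induction x with
    | top => simp
    | coe x =>
      rw [← ENNReal.toReal_le_toReal (by simp) (by finiteness),
        ENNReal.toReal_add (by simp) (by finiteness)]
      simp
      nlinarith [sq_nonneg ((x : ℝ) - 1 / 2)]
  have hbound : ∫⁻ ω, R ω ∂μ ≤ ENNReal.ofReal (μ.real A + 1 / 4 * μ.real (T ⁻¹' A) +
      (1 / 4 * μ.real Aᶜ + μ.real (T ⁻¹' Aᶜ))) := by
    rw [← lintegral_add_compl _ hA]
    have e1 : ∫⁻ ω in A, R ω ∂μ ≤ ENNReal.ofReal (μ.real A + 1 / 4 * μ.real (T ⁻¹' A)) := by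
      refine (lintegral_mono fun ω => h1 (R ω)).trans_eq ?_
      rw [lintegral_add_left measurable_const, lintegral_const_mul _ (by fun_prop), hν A hA,
        ENNReal.ofReal_add (by positivity) (by positivity), ENNReal.ofReal_mul (by norm_num),
        ofReal_measureReal]
      simp
    have e2 : ∫⁻ ω in Aᶜ, R ω ∂μ ≤ ENNReal.ofReal (1 / 4 * μ.real Aᶜ + μ.real (T ⁻¹' Aᶜ)) := by
      refine (lintegral_mono fun ω => h2 (R ω)).trans_eq ?_
      rw [lintegral_add_left measurable_const, hν _ hA.compl,
        ENNReal.ofReal_add (by positivity) (by positivity), ENNReal.ofReal_mul (by norm_num),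
        ofReal_measureReal]
      simp
    rw [ENNReal.ofReal_add (by positivity) (by positivity)]
    exact add_le_add e1 e2
  have h := (ENNReal.ofReal_le_ofReal_iff (by positivity)).1 (haff.trans hbound)
  rw [Set.preimage_compl, probReal_compl_eq_one_sub hA,
    probReal_compl_eq_one_sub (hT hA)] at h
  linarith

theorem lintegral_exp_gaussianReal (m : ℝ) :
    ∫⁻ y, ENNReal.ofReal (Real.exp (m * y / 2 - m ^ 2 / 4))
        ∂ProbabilityTheory.gaussianReal 0 1 = ENNReal.ofReal (Real.exp (-(m ^ 2 / 8))) := by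
  have hmgf : ∫ y, Real.exp (m / 2 * y) ∂ProbabilityTheory.gaussianReal 0 1 =
      Real.exp (m ^ 2 / 8) := by
    have h := congrFun (ProbabilityTheory.mgf_id_gaussianReal (μ := 0) (v := 1)) (m / 2)
    simp only [ProbabilityTheory.mgf, id] at h
    rw [h]
    congr 1
    push_cast
    ring
  have he (y : ℝ) : Real.exp (m * y / 2 - m ^ 2 / 4) =
      Real.exp (-(m ^ 2 / 4)) * Real.exp (m / 2 * y) := by
    rw [← Real.exp_add]
    congr 1
    ring
  simp_rw [he]
  rw [← ofReal_integral_eq_lintegral_ofReal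
    ((ProbabilityTheory.integrable_exp_mul_gaussianReal _).const_mul _)
    (ae_of_all _ fun y => by positivity), integral_const_mul, hmgf, ← Real.exp_add]
  congr 2
  ring

theorem affinity_gaussian_shear {E : Type*} [MeasurableSpace E] (P : Measure E)
    [IsProbabilityMeasure P] {φ : E → ℝ} (hφ : Measurable φ) {B : Set E} (hB : MeasurableSet B)
    {M : ℝ} (hφB : ∀ x, φ x ^ 2 ≤ B.indicator (fun _ => M) x) :
    ENNReal.ofReal (1 - M * P.real B / 8) ≤
      ∫⁻ p, ENNReal.ofReal (Real.exp (φ p.1 * p.2 / 2 - φ p.1 ^ 2 / 4))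
        ∂P.prod (ProbabilityTheory.gaussianReal 0 1) := by
  rw [lintegral_prod _ (by fun_prop)]
  simp_rw [lintegral_exp_gaussianReal]
  have hind : Integrable (B.indicator fun _ => M) P := (integrable_const M).indicator hB
  have hint : Integrable (fun x => Real.exp (-(φ x ^ 2 / 8))) P := by
    refine Integrable.mono' (integrable_const (1 : ℝ)) (by fun_prop) (ae_of_all _ fun x => ?_)
    rw [Real.norm_eq_abs, Real.abs_exp, Real.exp_le_one_iff]
    nlinarith [sq_nonneg (φ x)]
  rw [← ofReal_integral_eq_lintegral_ofReal hint (ae_of_all _ fun x => by positivity)]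
  refine ENNReal.ofReal_le_ofReal ?_
  have h : ∫ x, (1 - (B.indicator (fun _ => M) x) / 8) ∂P = 1 - M * P.real B / 8 := by
    rw [integral_sub (integrable_const _) (hind.div_const 8), integral_div,
      integral_indicator_const _ hB]
    simp [mul_comm]
  rw [← h]
  refine integral_mono ((integrable_const _).sub (hind.div_const 8)) hint fun x => ?_
  have := Real.add_one_le_exp (-(φ x ^ 2 / 8))
  have := hφB x
  dsimp only
  linarith

theorem measure_preimage_shear_le {U E : Type*} [MeasurableSpace U] [MeasurableSpace E]
    (PU : Measure U) [IsProbabilityMeasure PU] (P : Measure E) [IsProbabilityMeasure P]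
    {φ : E → ℝ} (hφ : Measurable φ) {B : Set E} (hB : MeasurableSet B) {M : ℝ}
    (hφB : ∀ x, φ x ^ 2 ≤ B.indicator (fun _ => M) x) (n : ℕ) (hn : 0 < n)
    (hM : n * (M * P.real B) ≤ 1 / 4)
    {A : Set (U × (Fin n → E × ℝ))} (hA : MeasurableSet A)
    (hμA : (PU.prod (Measure.pi fun _ : Fin n =>
      P.prod (ProbabilityTheory.gaussianReal 0 1))).real A ≤ 1 / 4) :
    (PU.prod (Measure.pi fun _ : Fin n => P.prod (ProbabilityTheory.gaussianReal 0 1))).real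
      ((fun ω => (ω.1, fun i => ((ω.2 i).1, (ω.2 i).2 + φ (ω.2 i).1))) ⁻¹' A) ≤ 3 / 4 := by
  set κ := P.prod (ProbabilityTheory.gaussianReal 0 1) with hκ
  set S : E × ℝ → E × ℝ := fun p => (p.1, p.2 + φ p.1) with hS_def
  have hS : Measurable S := by fun_prop
  set r : E × ℝ → ENNReal :=
    fun p => ENNReal.ofReal (Real.exp (φ p.1 * p.2 / 2 - φ p.1 ^ 2 / 4)) with hr_def
  have hr : Measurable r := by fun_prop
  have hmapS : κ.map S = κ.withDensity fun p => r p ^ 2 := map_shear_gaussianReal P hφ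
  have : IsProbabilityMeasure (κ.map S) := Measure.isProbabilityMeasure_map hS.aemeasurable
  have : IsProbabilityMeasure (κ.withDensity fun p => r p ^ 2) := hmapS ▸ this
  have hmappi : (Measure.pi fun _ : Fin n => κ).map (fun x i => S (x i)) =
      (Measure.pi fun _ : Fin n => κ).withDensity fun x => ∏ i, r (x i) ^ 2 := by
    rw [Measure.pi_map_pi fun _ => hS.aemeasurable]
    simp_rw [hmapS]
    exact pi_withDensity _ fun _ => by fun_prop
  refine measure_preimage_le_of_affinity _ (R := fun ω => ∏ i, r (ω.2 i)) (by fun_prop)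
    (by fun_prop) ?_ ?_ hA hμA
  · have h := Measure.map_prod_map PU (Measure.pi fun _ : Fin n => κ) measurable_id
      (show Measurable fun (x : Fin n → E × ℝ) i => S (x i) by fun_prop)
    rw [Measure.map_id, hmappi, prod_withDensity_right (by fun_prop)] at h
    simp_rw [← Finset.prod_pow]
    exact h.symm
  · have hb : 0 ≤ M * P.real B := by
      by_contra! hneg
      have hM0 : M < 0 := by
        by_contra! h
        exact hneg.not_ge (mul_nonneg h measureReal_nonneg)
      have hBne : B.Nonempty := by
        rw [Set.nonempty_iff_ne_empty]
        rintro rfl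
        simp at hneg
      obtain ⟨x, hx⟩ := hBne
      have := hφB x
      rw [Set.indicator_of_mem hx] at this
      nlinarith [sq_nonneg (φ x)]
    have hn1 : (1 : ℝ) ≤ n := by exact_mod_cast hn
    have hsmall : M * P.real B ≤ 1 / 4 := (le_mul_of_one_le_left hb hn1).trans hM
    rw [lintegral_prod _ (by fun_prop)]
    simp only [lintegral_const, measure_univ, mul_one]
    rw [lintegral_pi_prod (fun _ : Fin n => κ) fun _ => hr, Finset.prod_const, Finset.card_univ,
      Fintype.card_fin]
    calc ENNReal.ofReal (31 / 32) ≤ ENNReal.ofReal ((1 - M * P.real B / 8) ^ n) := by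
          refine ENNReal.ofReal_le_ofReal ?_
          have := one_add_mul_le_pow (a := -(M * P.real B / 8)) (by linarith) n
          rw [← sub_eq_add_neg] at this
          linarith
      _ = ENNReal.ofReal (1 - M * P.real B / 8) ^ n := ENNReal.ofReal_pow (by linarith) n
      _ ≤ _ := by
          gcongr
          exact affinity_gaussian_shear P hφ hB hφB

theorem hasLocalDim_of_bounds {X : Type*} [PseudoMetricSpace X] [MeasurableSpace X]
    {P : Measure X} {x : X} {d : ℕ} {c C : ℝ} (hc : 0 < c)
    (hlow : ∀ r : ℝ, 0 < r → r ≤ 1 → c * r ^ d ≤ P.real (closedBall x r))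
    (hup : ∀ r : ℝ, 0 < r → r ≤ 1 → P.real (closedBall x r) ≤ C * r ^ d) :
    HasLocalDim P x (d : ℝ) := by
  have hmem : ∀ᶠ r : ℝ in nhdsWithin 0 (Set.Ioi 0), 0 < r ∧ r ≤ 1 := by
    filter_upwards [Ioc_mem_nhdsGT (zero_lt_one (α := ℝ))] with r hr using hr
  refine lt_of_lt_of_le hc (le_liminf_of_le ?_ ?_)
  · refine IsBoundedUnder.isCoboundedUnder_ge ⟨C, ?_⟩
    rw [eventually_map]
    filter_upwards [hmem] with r hr
    rw [Real.rpow_natCast, div_le_iff₀ (pow_pos hr.1 d)]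
    exact hup r hr.1 hr.2
  · filter_upwards [hmem] with r hr
    rw [Real.rpow_natCast, le_div_iff₀ (pow_pos hr.1 d)]
    exact hlow r hr.1 hr.2

theorem hasLocalDim_volume_cube (d : ℕ) :
    HasLocalDim (volume : Measure (Cube d)) (fun _ => 0) (d : ℝ) := by
  have h (r : ℝ) (hr : 0 < r) (hr1 : r ≤ 1) :
      (volume : Measure (Cube d)).real (closedBall (fun _ => 0) r) = r ^ d := by
    have hb : closedBall (0 : Set.Icc (0 : ℝ) 1) r = Set.Iic ⟨r, hr.le, hr1⟩ := by
      ext x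
      simp only [mem_closedBall, Subtype.dist_eq, Set.Icc.coe_zero, dist_zero_right,
        Real.norm_eq_abs, abs_of_nonneg x.2.1, Set.mem_Iic, ← Subtype.coe_le_coe]
    have hv : (volume : Measure (Set.Icc (0 : ℝ) 1)) (closedBall 0 r) = ENNReal.ofReal r := by
      rw [hb]
      exact unitInterval.volume_Iic _
    rw [closedBall_pi _ hr.le, measureReal_def, volume_pi_pi]
    simp [hv, hr.le]
  exact hasLocalDim_of_bounds one_pos (fun r hr hr1 => by rw [h r hr hr1, one_mul])
    (fun r hr hr1 => by rw [h r hr hr1, one_mul])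

theorem gaussianReal_closedBall_le {r : ℝ} (hr : 0 ≤ r) :
    (ProbabilityTheory.gaussianReal 0 1).real (closedBall 0 r) ≤ r := by
  have hpdf (y : ℝ) : ProbabilityTheory.gaussianPDFReal 0 1 y ≤ 1 / 2 := by
    have h2 : (2 : ℝ) ≤ √(2 * Real.pi * ((1 : NNReal) : ℝ)) := by
      refine Real.le_sqrt_of_sq_le ?_
      push_cast
      nlinarith [Real.pi_gt_three]
    rw [ProbabilityTheory.gaussianPDFReal]
    refine (mul_le_mul (inv_anti₀ two_pos h2) (Real.exp_le_one_iff.2 ?_) (Real.exp_nonneg _)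
      (by norm_num)).trans (by norm_num)
    exact div_nonpos_of_nonpos_of_nonneg (neg_nonpos.2 (sq_nonneg _)) (by positivity)
  rw [measureReal_def, ProbabilityTheory.gaussianReal_apply_eq_integral _ one_ne_zero]
  rw [ENNReal.toReal_ofReal']
  refine max_le ?_ hr
  refine (setIntegral_mono (ProbabilityTheory.integrable_gaussianPDFReal 0 1).integrableOn
    (integrableOn_const measure_closedBall_lt_top.ne) hpdf).trans ?_
  simp [Real.closedBall_eq_Icc, hr]
  linarith

theorem exists_le_gaussianReal_closedBall :
    ∃ c : ℝ, 0 < c ∧ ∀ r : ℝ, 0 < r → r ≤ 1 →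
      c * r ≤ (ProbabilityTheory.gaussianReal 0 1).real (closedBall 0 r) := by
  refine ⟨ProbabilityTheory.gaussianPDFReal 0 1 1,
    ProbabilityTheory.gaussianPDFReal_pos 0 1 1 one_ne_zero, fun r hr hr1 => ?_⟩
  have h0 := (ProbabilityTheory.gaussianPDFReal_pos 0 1 1 one_ne_zero).le
  have hpdf (y : ℝ) (hy : y ∈ closedBall (0 : ℝ) r) :
      ProbabilityTheory.gaussianPDFReal 0 1 1 ≤ ProbabilityTheory.gaussianPDFReal 0 1 y := by
    rw [mem_closedBall, dist_zero_right, Real.norm_eq_abs] at hy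
    have : y ^ 2 ≤ 1 := by
      rw [← sq_abs]
      exact pow_le_one₀ (abs_nonneg y) (hy.trans hr1)
    rw [ProbabilityTheory.gaussianPDFReal, ProbabilityTheory.gaussianPDFReal]
    refine mul_le_mul_of_nonneg_left (Real.exp_le_exp.2 ?_) (by positivity)
    refine div_le_div_of_nonneg_right ?_ (by positivity)
    linarith
  rw [measureReal_def, ProbabilityTheory.gaussianReal_apply_eq_integral _ one_ne_zero,
    ENNReal.toReal_ofReal (integral_nonneg fun y =>
      ProbabilityTheory.gaussianPDFReal_nonneg 0 1 y)]
  refine le_trans ?_ (setIntegral_mono_on (f := fun _ => ProbabilityTheory.gaussianPDFReal 0 1 1)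
    (integrableOn_const measure_closedBall_lt_top.ne)
    (ProbabilityTheory.integrable_gaussianPDFReal 0 1).integrableOn measurableSet_closedBall hpdf)
  simp [Real.closedBall_eq_Icc, hr.le]
  nlinarith

/-- The standard Gaussian distribution on `ℝ^d`. -/
def stdGaussianPi (d : ℕ) : Measure (Fin d → ℝ) :=
  Measure.pi fun _ => ProbabilityTheory.gaussianReal 0 1

instance (d : ℕ) : IsProbabilityMeasure (stdGaussianPi d) := by
  unfold stdGaussianPi
  infer_instance

theorem stdGaussianPi_closedBall (d : ℕ) {r : ℝ} (hr : 0 ≤ r) :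
    (stdGaussianPi d).real (closedBall 0 r) =
      (ProbabilityTheory.gaussianReal 0 1).real (closedBall 0 r) ^ d := by
  rw [stdGaussianPi, closedBall_pi _ hr, measureReal_def, Measure.pi_pi]
  simp [measureReal_def]

theorem stdGaussianPi_closedBall_le (d : ℕ) {r : ℝ} (hr : 0 ≤ r) :
    (stdGaussianPi d).real (closedBall 0 r) ≤ r ^ d := by
  rw [stdGaussianPi_closedBall d hr]
  exact pow_le_pow_left₀ measureReal_nonneg (gaussianReal_closedBall_le hr) d

theorem hasLocalDim_stdGaussianPi (d : ℕ) : HasLocalDim (stdGaussianPi d) 0 (d : ℝ) := by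
  obtain ⟨c, hc, h⟩ := exists_le_gaussianReal_closedBall
  refine hasLocalDim_of_bounds (c := c ^ d) (C := 1) (pow_pos hc d) (fun r hr hr1 => ?_)
    fun r hr hr1 => ?_
  · rw [← mul_pow, stdGaussianPi_closedBall d hr.le]
    exact pow_le_pow_left₀ (by positivity) (h r hr hr1) d
  · rw [one_mul]
    exact stdGaussianPi_closedBall_le d hr.le

theorem integral_exp_mul_gaussianReal (t : ℝ) :
    ∫ x, Real.exp (x * t) ∂ProbabilityTheory.gaussianReal 0 1 = Real.exp (t ^ 2 / 2) := by
  have h := congrFun (ProbabilityTheory.mgf_id_gaussianReal (μ := 0) (v := 1)) t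
  simpa [ProbabilityTheory.mgf, mul_comm] using h

theorem subGaussianVec_stdGaussianPi (d : ℕ) : SubGaussianVec (stdGaussianPi d) := by
  intro t
  simp_rw [Real.exp_sum, stdGaussianPi]
  rw [integral_fintype_prod_eq_prod (fun j y => Real.exp (y * t j))]
  simp_rw [integral_exp_mul_gaussianReal]
  rw [← Real.exp_sum, Finset.sum_div]

theorem integral_eval_stdGaussianPi (d : ℕ) (j : Fin d) : ∫ x, x j ∂stdGaussianPi d = 0 := by
  rw [stdGaussianPi, integral_eval]
  exact ProbabilityTheory.integral_id_gaussianReal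

theorem bumpFn_nonneg (d : ℕ) (x : Fin d → ℝ) : 0 ≤ bumpFn d x := by
  unfold bumpFn
  split_ifs
  · exact Real.exp_nonneg _
  · exact le_rfl

theorem bumpFn_le_one (d : ℕ) (x : Fin d → ℝ) : bumpFn d x ≤ 1 := by
  unfold bumpFn
  split_ifs with h
  · rw [Real.exp_le_one_iff, sub_nonpos, le_div_iff₀ (by linarith)]
    have : 0 ≤ ∑ j, x j ^ 2 := Finset.sum_nonneg fun j _ => sq_nonneg _
    linarith
  · exact zero_le_one

theorem bumpFn_zero (d : ℕ) : bumpFn d 0 = 1 := by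
  simp [bumpFn]

theorem norm_lt_one_of_bumpFn_ne_zero {d : ℕ} {x : Fin d → ℝ} (h : bumpFn d x ≠ 0) :
    ‖x‖ < 1 := by
  have hx : ∑ j, x j ^ 2 < 1 := by
    by_contra hx
    exact h (if_neg hx)
  rw [pi_norm_lt_iff one_pos]
  intro j
  have := Finset.single_le_sum (f := fun j => x j ^ 2) (fun j _ => sq_nonneg _) (Finset.mem_univ j)
  rw [Real.norm_eq_abs, ← sq_lt_one_iff_abs_lt_one]
  exact this.trans_lt hx

theorem measurable_bumpFn (d : ℕ) : Measurable (bumpFn d) := by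
  unfold bumpFn
  exact Measurable.ite (measurableSet_lt (by fun_prop) (by fun_prop)) (by fun_prop) (by fun_prop)

/-- The rescaled bump `a h^s K((x - x₀)/h)`. -/
def scaledBump (s a h : ℝ) {d : ℕ} (x0 x : Fin d → ℝ) : ℝ :=
  a * h ^ s * bumpFn d (h⁻¹ • (x - x0))

theorem measurable_scaledBump (s a h : ℝ) {d : ℕ} (x0 : Fin d → ℝ) :
    Measurable (scaledBump s a h x0) :=
  ((measurable_bumpFn d).comp (by fun_prop)).const_mul _

theorem scaledBump_self (s a h : ℝ) {d : ℕ} (x0 : Fin d → ℝ) :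
    scaledBump s a h x0 x0 = a * h ^ s := by
  simp [scaledBump, bumpFn_zero]

theorem dist_le_holderSeminorm_mul {Z X : Type*} [MetricSpace Z] [PseudoMetricSpace X]
    {s : ℝ} {f : Z → X} (hf : holderSeminorm s f ≠ 0) (z z' : Z) :
    dist (f z) (f z') ≤ holderSeminorm s f * dist z z' ^ s := by
  by_cases hz : dist z z' = 0
  · rw [dist_eq_zero.1 hz, dist_self]
    refine mul_nonneg (Real.iSup_nonneg fun p => ?_) (Real.rpow_nonneg dist_nonneg _)
    split_ifs <;> positivity
  · have hbdd : BddAbove (Set.range fun p : Z × Z =>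
        if dist p.1 p.2 = 0 then 0 else dist (f p.1) (f p.2) / dist p.1 p.2 ^ s) := by
      by_contra h
      exact hf (Real.iSup_of_not_bddAbove h)
    have h := le_ciSup hbdd (z, z')
    simp only [hz, if_false] at h
    have hpos : 0 < dist z z' ^ s := Real.rpow_pos_of_pos (lt_of_le_of_ne dist_nonneg (Ne.symm hz)) s
    rwa [div_le_iff₀ hpos] at h

theorem globHolderBall_scaledBump {s L h : ℝ} {d : ℕ} (hL : 0 ≤ L) (hh : 0 < h)
    (hK : holderSeminorm s (bumpFn d) ≠ 0) (x0 : Fin d → ℝ) :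
    GlobHolderBall s L (scaledBump s (L / holderSeminorm s (bumpFn d)) h x0) := by
  intro x y
  have hH : 0 ≤ holderSeminorm s (bumpFn d) := by
    refine Real.iSup_nonneg fun p => ?_
    split_ifs <;> positivity
  have hd : dist (h⁻¹ • (x - x0)) (h⁻¹ • (y - x0)) = h⁻¹ * dist x y := by
    rw [dist_smul₀, dist_sub_right, Real.norm_of_nonneg (inv_nonneg.2 hh.le)]
  have hK' := dist_le_holderSeminorm_mul hK (h⁻¹ • (x - x0)) (h⁻¹ • (y - x0))
  rw [hd, Real.mul_rpow (inv_nonneg.2 hh.le) dist_nonneg, Real.inv_rpow hh.le] at hK'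
  have hhs : 0 < h ^ s := Real.rpow_pos_of_pos hh s
  have hc : 0 ≤ L / holderSeminorm s (bumpFn d) * h ^ s := by positivity
  unfold scaledBump
  rw [Real.dist_eq, ← mul_sub, abs_mul, abs_of_nonneg hc, ← Real.dist_eq]
  calc _ ≤ _ := mul_le_mul_of_nonneg_left hK' hc
    _ = L * dist x y ^ s := by field_simp

theorem sq_scaledBump_div_le {s a h σX σY : ℝ} {d : ℕ} (hh : 0 < h)
    (hσX : 0 < σX) (x0 x : Fin d → ℝ) :
    (scaledBump s a h x0 (x0 + σX • x) / σY) ^ 2 ≤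
      (closedBall 0 (h / σX)).indicator (fun _ => (a * h ^ s / σY) ^ 2) x := by
  unfold scaledBump
  rw [add_sub_cancel_left]
  by_cases hx : bumpFn d (h⁻¹ • σX • x) = 0
  · rw [hx]
    simp only [mul_zero, zero_div, ne_eq, OfNat.ofNat_ne_zero, not_false_eq_true, zero_pow]
    exact Set.indicator_nonneg (fun _ _ => sq_nonneg _) x
  · have hn := norm_lt_one_of_bumpFn_ne_zero hx
    rw [norm_smul, norm_smul, Real.norm_of_nonneg (inv_nonneg.2 hh.le),
      Real.norm_of_nonneg hσX.le, inv_mul_lt_iff₀ hh, mul_one] at hn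
    have hmem : x ∈ closedBall (0 : Fin d → ℝ) (h / σX) := by
      rw [mem_closedBall, dist_zero_right, le_div_iff₀ hσX, mul_comm]
      exact hn.le
    rw [Set.indicator_of_mem hmem, mul_div_right_comm, mul_pow]
    exact mul_le_of_le_one_right (sq_nonneg _)
      (pow_le_one₀ (bumpFn_nonneg d _) (bumpFn_le_one d _))

theorem exists_bandwidth {s a σX σY : ℝ} {d n : ℕ} (hs : 0 < s) (ha : 0 < a) (hσX : 0 < σX)
    (hσY : 0 < σY) (hd : 0 < d) (hn : 0 < n) :
    ∃ h : ℝ, 0 < h ∧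
      a ^ ((d : ℝ) / (2 * s + d)) * (4 * Real.sqrt ((d : ℝ) ^ d)) ^ (-s / (2 * s + d)) *
        (σX ^ (d : ℝ) * σY ^ 2 / n) ^ (s / (2 * s + d)) = a * h ^ s ∧
      n * ((a * h ^ s / σY) ^ 2 * (h / σX) ^ d) ≤ 1 / 4 := by
  have hd' : (1 : ℝ) ≤ d := by exact_mod_cast hd
  have hn' : (0 : ℝ) < n := by exact_mod_cast hn
  have hsqrt : 1 ≤ Real.sqrt ((d : ℝ) ^ d) := Real.one_le_sqrt.2 (one_le_pow₀ hd')
  set c := 4 * Real.sqrt ((d : ℝ) ^ d) with hc_def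
  have hc : 4 ≤ c := by linarith
  have hc0 : 0 < c := by linarith
  clear_value c
  set D := 2 * s + (d : ℝ) with hD_def
  have hD : 0 < D := by positivity
  set q := σX ^ (d : ℝ) * σY ^ 2 / n with hq_def
  have hq : 0 < q := by positivity
  set W := q * c⁻¹ * (a ^ (2 : ℝ))⁻¹ with hW_def
  have hW : 0 < W := by positivity
  have hpow : (W ^ (1 / D)) ^ s = W ^ (s / D) := by
    rw [← Real.rpow_mul hW.le, one_div_mul_eq_div]
  refine ⟨W ^ (1 / D), by positivity, ?_, ?_⟩
  · have e1 : a ^ ((d : ℝ) / D) = a * (a ^ (2 * (s / D)))⁻¹ := by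
      rw [← Real.rpow_neg ha.le, ← Real.rpow_one_add' ha.le]
      · congr 1
        field_simp
        rw [hD_def]
        ring
      · have : 1 + -(2 * (s / D)) = d / D := by
          field_simp
          rw [hD_def]
          ring
        rw [this]
        positivity
    rw [hpow, e1, hW_def, Real.mul_rpow (by positivity) (by positivity),
      Real.mul_rpow (by positivity) (by positivity), Real.inv_rpow (by positivity),
      Real.inv_rpow (by positivity), ← Real.rpow_mul ha.le, neg_div, Real.rpow_neg hc0.le]
    ring
  · have e2 : ((W ^ (1 / D)) ^ s) ^ 2 * (W ^ (1 / D)) ^ d = W := by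
      rw [← Real.rpow_natCast (W ^ (1 / D)) d, ← Real.rpow_natCast _ 2, ← Real.rpow_mul (by positivity) s,
        ← Real.rpow_add (by positivity), ← Real.rpow_mul hW.le]
      have : 1 / D * (s * (2 : ℕ) + d) = 1 := by
        push_cast
        rw [one_div_mul_eq_div, div_eq_one_iff_eq hD.ne', hD_def]
        ring
      rw [this, Real.rpow_one]
    have e3 : n * ((a * (W ^ (1 / D)) ^ s / σY) ^ 2 * (W ^ (1 / D) / σX) ^ d) =
        n * a ^ 2 * (((W ^ (1 / D)) ^ s) ^ 2 * (W ^ (1 / D)) ^ d) / (σY ^ 2 * σX ^ d) := by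
      simp only [mul_pow, div_pow]
      field_simp
    rw [e3, e2, hW_def, hq_def, Real.rpow_natCast, Real.rpow_two]
    have : n * a ^ 2 * (σX ^ d * σY ^ 2 / n * c⁻¹ * (a ^ 2)⁻¹) / (σY ^ 2 * σX ^ d) = c⁻¹ := by
      field_simp
    rw [this, one_div]
    exact inv_anti₀ (by norm_num) hc

/-- Whatever trajectories the querying rule `ζ` produces in the model with regression function `f`,
constant covariate map `x0`, and standard Gaussian noise, the estimator `est` errs by at least `δ`
with probability at least `1/4`. -/
def ForcesError {n dX dZ : ℕ} {U : Type} [MeasurableSpace U] (PU : Measure U)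
    (ζ : (i : Fin n) → (Fin (i : ℕ) → Cube dZ × (Fin dX → ℝ) × ℝ) → U → Cube dZ)
    (est : (Fin n → Cube dZ × (Fin dX → ℝ) × ℝ) → U → ℝ) (σX σY : ℝ) (x0 : Fin dX → ℝ)
    (δ : ℝ) (f : (Fin dX → ℝ) → ℝ) : Prop :=
  ∀ (Z : Fin n → U × (Fin n → (Fin dX → ℝ) × ℝ) → Cube dZ)
    (X : Fin n → U × (Fin n → (Fin dX → ℝ) × ℝ) → (Fin dX → ℝ))
    (Y : Fin n → U × (Fin n → (Fin dX → ℝ) × ℝ) → ℝ),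
    (∀ i ω, Z i ω = ζ i (fun j =>
        (Z ⟨(j : ℕ), j.2.trans i.2⟩ ω,
         X ⟨(j : ℕ), j.2.trans i.2⟩ ω,
         Y ⟨(j : ℕ), j.2.trans i.2⟩ ω)) ω.1) →
    (∀ i ω, X i ω = x0 + σX • (ω.2 i).1) →
    (∀ i ω, Y i ω = f (X i ω) + σY * (ω.2 i).2) →
    (1 : ℝ) / 4 ≤
      ((PU.prod (Measure.pi fun _ : Fin n =>
          (stdGaussianPi dX).prod (ProbabilityTheory.gaussianReal 0 1)))
        {ω | δ ≤ |est (fun i => (Z i ω, X i ω, Y i ω)) ω.1 - f x0|}).toReal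

theorem forcesError_zero {n dX dZ : ℕ} {U : Type} [MeasurableSpace U] (PU : Measure U)
    [IsProbabilityMeasure PU]
    (ζ : (i : Fin n) → (Fin (i : ℕ) → Cube dZ × (Fin dX → ℝ) × ℝ) → U → Cube dZ)
    (est : (Fin n → Cube dZ × (Fin dX → ℝ) × ℝ) → U → ℝ) (σX σY : ℝ) (x0 : Fin dX → ℝ)
    (f : (Fin dX → ℝ) → ℝ) : ForcesError PU ζ est σX σY x0 0 f := by
  intro Z X Y _ _ _
  simp only [abs_nonneg, Set.ofPred_true, measure_univ, ENNReal.toReal_one]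
  norm_num

theorem forcesError_or_forcesError {n dX dZ : ℕ} (hn : 0 < n) {U : Type} [MeasurableSpace U]
    (PU : Measure U) [IsProbabilityMeasure PU]
    (ζ : (i : Fin n) → (Fin (i : ℕ) → Cube dZ × (Fin dX → ℝ) × ℝ) → U → Cube dZ)
    (est : (Fin n → Cube dZ × (Fin dX → ℝ) × ℝ) → U → ℝ) {σX σY : ℝ} (hσY : σY ≠ 0)
    (x0 : Fin dX → ℝ) {f : (Fin dX → ℝ) → ℝ} (hf : Measurable f) {B : Set (Fin dX → ℝ)}
    (hB : MeasurableSet B) {M : ℝ}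
    (hfB : ∀ x, (f (x0 + σX • x) / σY) ^ 2 ≤ B.indicator (fun _ => M) x)
    (hM : n * (M * (stdGaussianPi dX).real B) ≤ 1 / 4) :
    ForcesError PU ζ est σX σY x0 (1 / 2 * f x0) (fun _ => 0) ∨
      ForcesError PU ζ est σX σY x0 (1 / 2 * f x0) f := by
  refine or_iff_not_imp_left.2 fun h0 => ?_
  unfold ForcesError at h0
  push Not at h0
  obtain ⟨Z, X, Y, hZ, hX, hY, hlt⟩ := h0
  intro Z' X' Y' hZ' hX' hY'
  set μ := PU.prod (Measure.pi fun _ : Fin n =>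
    (stdGaussianPi dX).prod (ProbabilityTheory.gaussianReal 0 1)) with hμ
  set A := {ω | 1 / 2 * f x0 ≤ |est (fun i => (Z i ω, X i ω, Y i ω)) ω.1 - 0|} with hA
  set T : U × (Fin n → (Fin dX → ℝ) × ℝ) → U × (Fin n → (Fin dX → ℝ) × ℝ) :=
    fun ω => (ω.1, fun i => ((ω.2 i).1, (ω.2 i).2 + f (x0 + σX • (ω.2 i).1) / σY)) with hT_def
  have hφ : Measurable fun x => f (x0 + σX • x) / σY := by fun_prop
  have hT : Measurable T := by fun_prop
  have hAm : μ.real (toMeasurable μ A) ≤ 1 / 4 := by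
    rw [measureReal_def, measure_toMeasurable]
    exact hlt.le
  have hTA : μ.real (T ⁻¹' toMeasurable μ A) ≤ 3 / 4 :=
    measure_preimage_shear_le PU (stdGaussianPi dX) hφ hB hfB n hn hM
      (measurableSet_toMeasurable μ A) hAm
  have hXT (i : Fin n) (ω) : X i (T ω) = X' i ω := by rw [hX, hX']
  have hYT (i : Fin n) (ω) : Y i (T ω) = Y' i ω := by
    rw [hY, hY', hX']
    simp only [hT_def]
    field_simp
    ring
  have hZT (ω) (k : ℕ) : ∀ hk : k < n, Z ⟨k, hk⟩ (T ω) = Z' ⟨k, hk⟩ ω := by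
    induction k using Nat.strong_induction_on with
    | _ k ih =>
      intro hk
      rw [hZ, hZ']
      have : (fun j : Fin k => (Z ⟨j, j.2.trans hk⟩ (T ω), X ⟨j, j.2.trans hk⟩ (T ω),
          Y ⟨j, j.2.trans hk⟩ (T ω))) = fun j : Fin k => (Z' ⟨j, j.2.trans hk⟩ ω,
          X' ⟨j, j.2.trans hk⟩ ω, Y' ⟨j, j.2.trans hk⟩ ω) := by
        funext j
        rw [hXT, hYT, ih j j.2]
      exact congrArg (fun v => ζ ⟨k, hk⟩ v ω.1) this
  have hsub : (T ⁻¹' toMeasurable μ A)ᶜ ⊆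
      {ω | 1 / 2 * f x0 ≤ |est (fun i => (Z' i ω, X' i ω, Y' i ω)) ω.1 - f x0|} := by
    intro ω hω
    have hωA : T ω ∉ A := fun h => hω (subset_toMeasurable μ A h)
    have hdata : (fun i => (Z i (T ω), X i (T ω), Y i (T ω))) =
        fun i => (Z' i ω, X' i ω, Y' i ω) := by
      funext i
      rw [hXT, hYT, hZT ω i i.2]
    rw [hA, Set.mem_ofPred_eq, hdata, not_le, sub_zero] at hωA
    have h1 := (abs_lt.1 hωA).2
    rw [Set.mem_ofPred_eq, abs_sub_comm]
    refine le_trans ?_ (le_abs_self _)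
    linarith
  have h1 := measureReal_mono (μ := μ) hsub
  rw [probReal_compl_eq_one_sub (hT (measurableSet_toMeasurable μ A))] at h1
  change 1 / 4 ≤ μ.real _
  linarith

/-- **Proposition 4 (Active minimax lower bound, large covariate and response noise),**
with the explicit threshold
`(1/2)(L_f/‖K_{d_X}‖_{C^{s_f}})^{d_X/(2s_f+d_X)} (4 √(d_X^{d_X}))^{-s_f/(2s_f+d_X)}
(σ_X^{d_X} σ_Y²/n)^{s_f/(2s_f+d_X)}`. -/
theorem active_lower_bound_high_noise
    (sg sf Lg Lf : ℝ) (dX dZ : ℕ)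
    (hsg : sg ∈ Set.Ioc (0:ℝ) 1) (hsf : sf ∈ Set.Ioc (0:ℝ) 1)
    (hLg : 0 < Lg) (hLf : 0 < Lf) (hdX : 0 < dX) (hdZ : 0 < dZ) :
      ∀ (n : ℕ), 0 < n →
      ∀ (σX σY : ℝ), 0 ≤ σX → 0 ≤ σY →
      ∀ x0 : Fin dX → ℝ,
      ∀ (U : Type) [MeasurableSpace U] (PU : Measure U) [IsProbabilityMeasure PU]
        (ζ : (i : Fin n) → (Fin (i : ℕ) → Cube dZ × (Fin dX → ℝ) × ℝ) → U → Cube dZ)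
        (est : (Fin n → Cube dZ × (Fin dX → ℝ) × ℝ) → U → ℝ),
        (∀ i : Fin n, Measurable
          (fun p : (Fin (i : ℕ) → Cube dZ × (Fin dX → ℝ) × ℝ) × U => ζ i p.1 p.2)) →
        Measurable (fun p : (Fin n → Cube dZ × (Fin dX → ℝ) × ℝ) × U => est p.1 p.2) →
      ∃ (g : Cube dZ → Fin dX → ℝ) (f : (Fin dX → ℝ) → ℝ)
        (PZ : Measure (Cube dZ)) (PeX : Measure (Fin dX → ℝ)) (PeY : Measure ℝ),
        IsProbabilityMeasure PZ ∧ IsProbabilityMeasure PeX ∧ IsProbabilityMeasure PeY ∧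
        GlobHolderBall sg Lg g ∧ GlobHolderBall sf Lf f ∧
        (∃ z0 : Cube dZ, g z0 = x0 ∧ HasLocalDim PZ z0 (dZ : ℝ)) ∧
        HasLocalDim PeX 0 (dX : ℝ) ∧
        SubGaussianVec PeX ∧ SubGaussianReal PeY ∧
        (∀ j, ∫ x, x j ∂PeX = 0) ∧ (∫ y, y ∂PeY = 0) ∧
        ∀ (Z : Fin n → U × (Fin n → (Fin dX → ℝ) × ℝ) → Cube dZ)
          (X : Fin n → U × (Fin n → (Fin dX → ℝ) × ℝ) → (Fin dX → ℝ))
          (Y : Fin n → U × (Fin n → (Fin dX → ℝ) × ℝ) → ℝ),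
          (∀ i ω, Z i ω = ζ i (fun j =>
              (Z ⟨(j : ℕ), j.2.trans i.2⟩ ω,
               X ⟨(j : ℕ), j.2.trans i.2⟩ ω,
               Y ⟨(j : ℕ), j.2.trans i.2⟩ ω)) ω.1) →
          (∀ i ω, X i ω = g (Z i ω) + σX • (ω.2 i).1) →
          (∀ i ω, Y i ω = f (X i ω) + σY * (ω.2 i).2) →
          (1 : ℝ) / 4 ≤
            ((PU.prod (Measure.pi fun _ : Fin n => PeX.prod PeY))
              {ω | (1 / 2) * (Lf / holderSeminorm sf (bumpFn dX)) ^ ((dX : ℝ) / (2 * sf + (dX : ℝ))) * (4 * Real.sqrt ((dX : ℝ) ^ (dX : ℕ))) ^ (-sf / (2 * sf + (dX : ℝ))) * (σX ^ (dX : ℝ) * σY ^ 2 / n) ^ (sf / (2 * sf + (dX : ℝ))) ≤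
                |est (fun i => (Z i ω, X i ω, Y i ω)) ω.1 - f x0|}).toReal := by
  intro n hn σX σY hσX hσY x0 U _ PU _ ζ est _ _
  set K := holderSeminorm sf (bumpFn dX) with hK_def
  have hD : 0 < 2 * sf + (dX : ℝ) := add_pos_of_pos_of_nonneg (mul_pos two_pos hsf.1) (by simp)
  have hdX' : (0 : ℝ) < dX := by exact_mod_cast hdX
  suffices h : ∃ f : (Fin dX → ℝ) → ℝ, GlobHolderBall sf Lf f ∧ ForcesError PU ζ est σX σY x0
      ((1 / 2) * (Lf / K) ^ ((dX : ℝ) / (2 * sf + (dX : ℝ))) *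
        (4 * Real.sqrt ((dX : ℝ) ^ (dX : ℕ))) ^ (-sf / (2 * sf + (dX : ℝ))) *
        (σX ^ (dX : ℝ) * σY ^ 2 / n) ^ (sf / (2 * sf + (dX : ℝ)))) f by
    obtain ⟨f, hf, hfe⟩ := h
    refine ⟨fun _ => x0, f, volume, stdGaussianPi dX, ProbabilityTheory.gaussianReal 0 1,
      inferInstance, inferInstance, inferInstance, fun z z' => ?_, hf,
      ⟨fun _ => 0, rfl, hasLocalDim_volume_cube dZ⟩, hasLocalDim_stdGaussianPi dX,
      subGaussianVec_stdGaussianPi dX, fun t => (integral_exp_mul_gaussianReal t).le,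
      integral_eval_stdGaussianPi dX, ProbabilityTheory.integral_id_gaussianReal, hfe⟩
    rw [dist_self]
    positivity
  have hzero : GlobHolderBall sf Lf fun _ : Fin dX → ℝ => (0 : ℝ) := fun z z' => by
    rw [dist_self]
    positivity
  by_cases hdeg : K = 0 ∨ σX = 0 ∨ σY = 0
  · refine ⟨fun _ => 0, hzero, ?_⟩
    convert forcesError_zero PU ζ est σX σY x0 fun _ => 0 using 1
    rcases hdeg with h | h | h
    · rw [h, div_zero, Real.zero_rpow (div_pos hdX' hD).ne']
      ring
    · rw [h, Real.zero_rpow hdX'.ne', zero_mul, zero_div, Real.zero_rpow (div_pos hsf.1 hD).ne',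
        mul_zero]
    · rw [h, zero_pow two_ne_zero, mul_zero, zero_div, Real.zero_rpow (div_pos hsf.1 hD).ne',
        mul_zero]
  · push Not at hdeg
    obtain ⟨hK, hσX0, hσY0⟩ := hdeg
    replace hσX := lt_of_le_of_ne hσX hσX0.symm
    replace hσY := lt_of_le_of_ne hσY hσY0.symm
    have hKpos : 0 < K := by
      refine lt_of_le_of_ne (Real.iSup_nonneg fun p => ?_) hK.symm
      split_ifs <;> positivity
    obtain ⟨h, hh, hthr, hinfo⟩ :=
      exists_bandwidth (n := n) hsf.1 (div_pos hLf hKpos) hσX hσY hdX hn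
    rw [mul_assoc (1 / 2 : ℝ), mul_assoc (1 / 2 : ℝ), hthr,
      ← scaledBump_self sf (Lf / K) h x0]
    rcases forcesError_or_forcesError hn PU ζ est hσY0 x0
      (measurable_scaledBump sf (Lf / K) h x0) measurableSet_closedBall
      (sq_scaledBump_div_le hh hσX x0) (le_trans (by
        gcongr
        exact stdGaussianPi_closedBall_le dX (by positivity)) hinfo) with h0 | h1
    · exact ⟨_, hzero, h0⟩
    · exact ⟨_, globHolderBall_scaledBump hLf.le hh hK x0, h1⟩

end
end
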